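/- arXiv:2508.13254 — 3 statements merged into one kernel-verified Lean document; each statement's English description precedes it below -/
import Mathlib

section
/- For all integers k and r with 1 ≤ r ≤ k−1, one has Σ_{(k₁,…,k_r)} ζ_q(k₁,…,k_r) = ζ_q(k), where the sum ranges over all tuples (k₁,…,k_r) of positive integers with k₁+⋯+k_r = k and k_r ≥ 2 (all the series involved converge absolutely). -/
open Complex

/-- The `q`-analogue `[n]_q = (1 - q^n)/(1 - q)` of a natural number `n`. -/
noncomputable def qnum (q : ℝ) (n : ℕ) : ℝ := (1 - q ^ n) / (1 - q)

/-- The general term `∏_j q^{(s_j−1)n_j}/[n_j]_q^{s_j}` of the `q`-multiple zeta series. -/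
noncomputable def zetaTerm (q : ℝ) {r : ℕ} (s : Fin r → ℂ) (n : Fin r → ℕ) : ℂ :=
  ∏ j, (q : ℂ) ^ ((s j - 1) * (n j : ℂ)) / ((qnum q (n j) : ℂ) ^ (s j))

/-- Strictly increasing `r`-tuples of positive integers `0 < n₁ < ⋯ < n_r`. -/
def qIdx (r : ℕ) : Type := {n : Fin r → ℕ // StrictMono n ∧ ∀ j, 0 < n j}

open Filter Topology

section Connector

variable {q x : ℝ}

/-- The denominator `[n]_q - x q^n` of the generating function of the `q^{(k-1)n}/[n]_q^k`. -/
noncomputable def qden (q x : ℝ) (n : ℕ) : ℝ := qnum q n - x * q ^ n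

/-- The ratio `q^n/[n]_q`. -/
noncomputable def qratio (q : ℝ) (n : ℕ) : ℝ := q ^ n / qnum q n

/-- The product `∏_{j=1}^n ([j]_q - x q^j)`. -/
noncomputable def qdenProd (q x : ℝ) (n : ℕ) : ℝ := ∏ j ∈ Finset.range n, qden q x (j + 1)

/-- The connector of the Seki–Yamamoto connected sum. -/
noncomputable def connector (q x : ℝ) (n m : ℕ) : ℝ :=
  q ^ (n * m) * qdenProd q x n * qdenProd q x m / qdenProd q x (n + m)

lemma qnum_add (hq1 : q < 1) (n m : ℕ) : qnum q (n + m) = qnum q n + q ^ n * qnum q m := by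
  have : 1 - q ≠ 0 := by linarith
  unfold qnum
  field_simp
  ring

lemma qnum_nonneg (hq0 : 0 < q) (hq1 : q < 1) (n : ℕ) : 0 ≤ qnum q n :=
  div_nonneg (sub_nonneg.2 (pow_le_one₀ hq0.le hq1.le)) (by linarith)

lemma one_le_qnum (hq0 : 0 < q) (hq1 : q < 1) {n : ℕ} (hn : 0 < n) : 1 ≤ qnum q n := by
  unfold qnum
  rw [le_div_iff₀ (by linarith)]
  have := pow_le_of_le_one hq0.le hq1.le hn.ne'
  linarith

lemma qnum_pos (hq0 : 0 < q) (hq1 : q < 1) {n : ℕ} (hn : 0 < n) : 0 < qnum q n :=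
  one_pos.trans_le (one_le_qnum hq0 hq1 hn)

lemma qratio_nonneg (hq0 : 0 < q) (hq1 : q < 1) (n : ℕ) : 0 ≤ qratio q n :=
  div_nonneg (pow_nonneg hq0.le _) (qnum_nonneg hq0 hq1 n)

lemma qratio_le_pow (hq0 : 0 < q) (hq1 : q < 1) {n : ℕ} (hn : 0 < n) : qratio q n ≤ q ^ n :=
  div_le_self (pow_nonneg hq0.le _) (one_le_qnum hq0 hq1 hn)

lemma qratio_le (hq0 : 0 < q) (hq1 : q < 1) {n : ℕ} (hn : 0 < n) : qratio q n ≤ q :=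
  (qratio_le_pow hq0 hq1 hn).trans (pow_le_of_le_one hq0.le hq1.le hn.ne')

lemma one_sub_le_qden (hq0 : 0 < q) (hq1 : q < 1) (hx0 : 0 ≤ x) (hx1 : x ≤ 1) {n : ℕ}
    (hn : 0 < n) : 1 - q ≤ qden q x n := by
  have h1 := one_le_qnum hq0 hq1 hn
  have h2 := pow_le_of_le_one hq0.le hq1.le hn.ne'
  have h3 : 0 ≤ q ^ n := pow_nonneg hq0.le _
  unfold qden
  nlinarith

lemma qden_pos (hq0 : 0 < q) (hq1 : q < 1) (hx0 : 0 ≤ x) (hx1 : x ≤ 1) {n : ℕ}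
    (hn : 0 < n) : 0 < qden q x n :=
  (sub_pos.2 hq1).trans_le (one_sub_le_qden hq0 hq1 hx0 hx1 hn)

lemma qden_add (hq1 : q < 1) (n m : ℕ) : qden q x (n + m) = qnum q n + q ^ n * qden q x m := by
  unfold qden
  rw [qnum_add hq1, pow_add]
  ring

lemma qden_le_qden_add (hq0 : 0 < q) (hq1 : q < 1) (hx0 : 0 ≤ x) (n m : ℕ) :
    qden q x m ≤ qden q x (n + m) := by
  unfold qden
  have h1 := qnum_nonneg hq0 hq1 n
  have h2 : q ^ (n + m) ≤ q ^ m := pow_le_pow_of_le_one hq0.le hq1.le (by omega)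
  have h3 := pow_nonneg hq0.le m
  rw [add_comm n m] at *
  rw [qnum_add hq1]
  nlinarith [mul_le_mul_of_nonneg_left h2 hx0, mul_nonneg h3 h1]

lemma qdenProd_pos (hq0 : 0 < q) (hq1 : q < 1) (hx0 : 0 ≤ x) (hx1 : x ≤ 1) (n : ℕ) :
    0 < qdenProd q x n :=
  Finset.prod_pos fun _ _ => qden_pos hq0 hq1 hx0 hx1 (Nat.succ_pos _)

lemma connector_nonneg (hq0 : 0 < q) (hq1 : q < 1) (hx0 : 0 ≤ x) (hx1 : x ≤ 1) (n m : ℕ) :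
    0 ≤ connector q x n m := by
  have h := qdenProd_pos hq0 hq1 hx0 hx1
  exact div_nonneg (mul_nonneg (mul_nonneg (pow_nonneg hq0.le _) (h n).le) (h m).le) (h _).le

lemma connector_comm (n m : ℕ) : connector q x n m = connector q x m n := by
  unfold connector
  rw [mul_comm n m, add_comm n m]
  ring

lemma connector_zero_right (hq0 : 0 < q) (hq1 : q < 1) (hx0 : 0 ≤ x) (hx1 : x ≤ 1) (n : ℕ) :
    connector q x n 0 = 1 := by
  have h := (qdenProd_pos hq0 hq1 hx0 hx1 n).ne'
  have h0 : qdenProd q x 0 = 1 := Finset.prod_range_zero _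
  unfold connector
  rw [add_zero, mul_zero, pow_zero, h0, one_mul, mul_one, div_self h]

lemma connector_succ_right (hq0 : 0 < q) (hq1 : q < 1) (hx0 : 0 ≤ x) (hx1 : x ≤ 1) (n m : ℕ) :
    connector q x n (m + 1) =
      connector q x n m * (q ^ n * qden q x (m + 1) / qden q x (n + (m + 1))) := by
  have h := (qdenProd_pos hq0 hq1 hx0 hx1 (n + m)).ne'
  have h' := (qden_pos hq0 hq1 hx0 hx1 (show 0 < n + (m + 1) by omega)).ne'
  have e1 : qdenProd q x (m + 1) = qdenProd q x m * qden q x (m + 1) := Finset.prod_range_succ _ _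
  have e2 : qdenProd q x (n + (m + 1)) = qdenProd q x (n + m) * qden q x (n + (m + 1)) :=
    Finset.prod_range_succ _ _
  unfold connector
  rw [e1, e2]
  field_simp
  ring

lemma connector_le_pow (hq0 : 0 < q) (hq1 : q < 1) (hx0 : 0 ≤ x) (hx1 : x ≤ 1) {n : ℕ}
    (hn : 0 < n) (m : ℕ) : connector q x n m ≤ q ^ m := by
  induction m with
  | zero => simp [connector_zero_right hq0 hq1 hx0 hx1]
  | succ m ih =>
    rw [connector_succ_right hq0 hq1 hx0 hx1, pow_succ]
    have hd := qden_pos hq0 hq1 hx0 hx1 (show 0 < n + (m + 1) by omega)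
    have hd' := qden_pos hq0 hq1 hx0 hx1 (show 0 < m + 1 by omega)
    refine mul_le_mul ih ?_ (by positivity) (by positivity)
    rw [div_le_iff₀ hd]
    exact mul_le_mul (pow_le_of_le_one hq0.le hq1.le hn.ne') (qden_le_qden_add hq0 hq1 hx0 _ _)
      hd'.le hq0.le

lemma qratio_mul_connector_sub (hq0 : 0 < q) (hq1 : q < 1) (hx0 : 0 ≤ x) (hx1 : x ≤ 1) {n : ℕ}
    (hn : 0 < n) (m : ℕ) :
    qratio q n * (connector q x n m - connector q x n (m + 1)) =
      connector q x n (m + 1) / qden q x (m + 1) := by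
  have hd := (qden_pos hq0 hq1 hx0 hx1 (show 0 < n + (m + 1) by omega)).ne'
  have hd' := (qden_pos hq0 hq1 hx0 hx1 (show 0 < m + 1 by omega)).ne'
  have hn' := (qnum_pos hq0 hq1 hn).ne'
  rw [connector_succ_right hq0 hq1 hx0 hx1, qratio]
  have e := qden_add (x := x) hq1 n (m + 1)
  field_simp
  linear_combination connector q x n m * e

/-- The transport relation of the connected sum. -/
lemma hasSum_connector_div_qden (hq0 : 0 < q) (hq1 : q < 1) (hx0 : 0 ≤ x) (hx1 : x ≤ 1) {n : ℕ}
    (hn : 0 < n) (a : ℕ) :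
    HasSum (fun i => connector q x n (a + i + 1) / qden q x (a + i + 1))
      (qratio q n * connector q x n a) := by
  rw [hasSum_iff_tendsto_nat_of_nonneg fun i => div_nonneg (connector_nonneg hq0 hq1 hx0 hx1 _ _)
    (qden_pos hq0 hq1 hx0 hx1 (by omega)).le]
  have hs : ∀ N, ∑ i ∈ Finset.range N, connector q x n (a + i + 1) / qden q x (a + i + 1) =
      qratio q n * (connector q x n a - connector q x n (a + N)) := by
    intro N
    simp_rw [← qratio_mul_connector_sub hq0 hq1 hx0 hx1 hn]
    rw [← Finset.mul_sum]
    exact congrArg _ (Finset.sum_range_sub' (fun i => connector q x n (a + i)) N)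
  simp_rw [hs]
  have h0 : Tendsto (fun m => connector q x n m) atTop (𝓝 0) :=
    squeeze_zero (connector_nonneg hq0 hq1 hx0 hx1 n) (connector_le_pow hq0 hq1 hx0 hx1 hn)
      (tendsto_pow_atTop_nhds_zero_of_lt_one hq0.le hq1)
  have h1 : Tendsto (fun N => connector q x n (a + N)) atTop (𝓝 0) := by
    simpa only [add_comm a] using (tendsto_add_atTop_iff_nat a).2 h0
  simpa using (h1.const_sub (connector q x n a)).const_mul (qratio q n)

lemma tsum_ofReal_connector (hq0 : 0 < q) (hq1 : q < 1) (hx0 : 0 ≤ x) (hx1 : x ≤ 1) {n : ℕ}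
    (hn : 0 < n) (a : ℕ) :
    ∑' i, ENNReal.ofReal (1 / qden q x (a + i + 1)) *
        ENNReal.ofReal (connector q x n (a + i + 1)) =
      ENNReal.ofReal (qratio q n) * ENNReal.ofReal (connector q x n a) := by
  have h := hasSum_connector_div_qden hq0 hq1 hx0 hx1 hn a
  rw [← ENNReal.ofReal_mul (qratio_nonneg hq0 hq1 n), ← h.tsum_eq,
    ENNReal.ofReal_tsum_of_nonneg _ h.summable]
  · refine tsum_congr fun i => ?_
    rw [← ENNReal.ofReal_mul (one_div_nonneg.2 (qden_pos hq0 hq1 hx0 hx1 (by omega)).le)]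
    congr 1
    ring
  · exact fun i => div_nonneg (connector_nonneg hq0 hq1 hx0 hx1 _ _)
      (qden_pos hq0 hq1 hx0 hx1 (by omega)).le

end Connector

section Index

open scoped ENNReal

/-- One-element index tuples are positive integers. -/
def qIdxOneEquiv : ℕ ≃ qIdx 1 where
  toFun i := ⟨fun _ => i + 1, Subsingleton.strictMono _, fun _ => Nat.succ_pos i⟩
  invFun n := n.1 0 - 1
  left_inv i := rfl
  right_inv n := by
    apply Subtype.ext
    funext j
    have := n.2.2 0
    rw [Subsingleton.elim j 0]
    change n.1 0 - 1 + 1 = n.1 0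
    omega

/-- An index tuple is determined by its initial part and the last gap. -/
def qIdxSnocEquiv (r : ℕ) : qIdx (r + 1) × ℕ ≃ qIdx (r + 2) where
  toFun p := ⟨Fin.snoc (α := fun _ => ℕ) p.1.1 (p.1.1 (Fin.last r) + p.2 + 1), by
    refine ⟨Fin.strictMono_iff_lt_succ.2 fun i => ?_, fun j => ?_⟩
    · induction i using Fin.lastCases with
      | last =>
        rw [Fin.succ_last, Fin.snoc_last, Fin.snoc_castSucc]
        omega
      | cast i =>
        rw [Fin.succ_castSucc, Fin.snoc_castSucc, Fin.snoc_castSucc]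
        exact p.1.2.1 i.castSucc_lt_succ
    · induction j using Fin.lastCases with
      | last =>
        rw [Fin.snoc_last]
        omega
      | cast j =>
        rw [Fin.snoc_castSucc]
        exact p.1.2.2 j⟩
  invFun n := (⟨fun j => n.1 j.castSucc, fun _ _ h => n.2.1 (Fin.castSucc_lt_castSucc_iff.2 h),
    fun j => n.2.2 _⟩, n.1 (Fin.last (r + 1)) - n.1 (Fin.last r).castSucc - 1)
  left_inv p := by
    refine Prod.ext (Subtype.ext (funext fun j => ?_)) ?_
    · exact Fin.snoc_castSucc (α := fun _ => ℕ) _ _ _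
    · simp only [Fin.snoc_last, Fin.snoc_castSucc]
      omega
  right_inv n := by
    refine Subtype.ext (funext fun j => ?_)
    induction j using Fin.lastCases with
    | last =>
      have h : n.1 (Fin.last r).castSucc < n.1 (Fin.last (r + 1)) :=
        n.2.1 (Fin.castSucc_lt_last _)
      simp only [Fin.snoc_last]
      omega
    | cast j => simp only [Fin.snoc_castSucc]

lemma tsum_qIdx_one (F : (Fin 1 → ℕ) → ℝ≥0∞) :
    ∑' n : qIdx 1, F n.1 = ∑' i : ℕ, F (fun _ => i + 1) :=
  (qIdxOneEquiv.tsum_eq (fun n : qIdx 1 => F n.1)).symm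

lemma tsum_qIdx_succ (r : ℕ) (g φ : ℕ → ℝ≥0∞) :
    ∑' n : qIdx (r + 2), (∏ j, g (n.1 j)) * φ (n.1 (Fin.last _)) =
      ∑' n : qIdx (r + 1), (∏ j, g (n.1 j)) *
        ∑' i, g (n.1 (Fin.last _) + i + 1) * φ (n.1 (Fin.last _) + i + 1) := by
  rw [← (qIdxSnocEquiv r).tsum_eq, ENNReal.tsum_prod']
  refine tsum_congr fun n => ?_
  rw [← ENNReal.tsum_mul_left]
  refine tsum_congr fun i => ?_
  rw [Fin.prod_univ_castSucc]
  have h1 : ∀ j : Fin (r + 1), (qIdxSnocEquiv r (n, i)).1 j.castSucc = n.1 j := fun j =>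
    Fin.snoc_castSucc (α := fun _ => ℕ) _ _ _
  have h2 : (qIdxSnocEquiv r (n, i)).1 (Fin.last _) = n.1 (Fin.last r) + i + 1 :=
    Fin.snoc_last (α := fun _ => ℕ) _ _
  simp_rw [h1, h2, mul_assoc]

lemma prod_tsum_eq_tsum_prod (r : ℕ) (F : Fin r → ℕ → ℝ≥0∞) :
    ∏ j, ∑' e, F j e = ∑' e : Fin r → ℕ, ∏ j, F j (e j) := by
  induction r with
  | zero => simp
  | succ r ih =>
    rw [← (Fin.consEquiv fun _ => ℕ).tsum_eq, ENNReal.tsum_prod', Fin.prod_univ_succ,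
      ← ENNReal.tsum_mul_right]
    refine tsum_congr fun a => ?_
    rw [ih, ← ENNReal.tsum_mul_left]
    refine tsum_congr fun e => ?_
    simp [Fin.prod_univ_succ, Fin.consEquiv]

end Index

section GeneratingFunction

open scoped ENNReal

variable {q x : ℝ}

lemma tsum_qIdx_connector (hq0 : 0 < q) (hq1 : q < 1) (hx0 : 0 ≤ x) (hx1 : x ≤ 1) (r s : ℕ) :
    ∑' n : qIdx (r + 1), (∏ j, ENNReal.ofReal (1 / qden q x (n.1 j))) *
        ∑' m, ENNReal.ofReal (qratio q (m + 1)) ^ s * ENNReal.ofReal (1 / qden q x (m + 1)) *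
          ENNReal.ofReal (connector q x (m + 1) (n.1 (Fin.last _))) =
      ∑' m, ENNReal.ofReal (qratio q (m + 1)) ^ (s + r + 1) *
        ENNReal.ofReal (1 / qden q x (m + 1)) := by
  have transport : ∀ s a : ℕ,
      ∑' i, ENNReal.ofReal (1 / qden q x (a + i + 1)) *
        ∑' m, ENNReal.ofReal (qratio q (m + 1)) ^ s * ENNReal.ofReal (1 / qden q x (m + 1)) *
          ENNReal.ofReal (connector q x (m + 1) (a + i + 1)) =
      ∑' m, ENNReal.ofReal (qratio q (m + 1)) ^ (s + 1) * ENNReal.ofReal (1 / qden q x (m + 1)) *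
          ENNReal.ofReal (connector q x (m + 1) a) := by
    intro s a
    simp_rw [← ENNReal.tsum_mul_left]
    rw [ENNReal.tsum_comm]
    refine tsum_congr fun m => ?_
    simp_rw [mul_left_comm (ENNReal.ofReal (1 / qden q x (a + _ + 1)))]
    rw [ENNReal.tsum_mul_left, tsum_ofReal_connector hq0 hq1 hx0 hx1 m.succ_pos]
    ring
  induction r generalizing s with
  | zero =>
    rw [tsum_qIdx_one fun n => (∏ j, ENNReal.ofReal (1 / qden q x (n j))) *
        ∑' m, ENNReal.ofReal (qratio q (m + 1)) ^ s * ENNReal.ofReal (1 / qden q x (m + 1)) *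
          ENNReal.ofReal (connector q x (m + 1) (n (Fin.last _)))]
    have h := transport s 0
    simp only [zero_add, connector_zero_right hq0 hq1 hx0 hx1, ENNReal.ofReal_one, mul_one] at h
    simpa using h
  | succ r ih =>
    rw [tsum_qIdx_succ r (fun b => ENNReal.ofReal (1 / qden q x b)) fun b =>
      ∑' m, ENNReal.ofReal (qratio q (m + 1)) ^ s * ENNReal.ofReal (1 / qden q x (m + 1)) *
          ENNReal.ofReal (connector q x (m + 1) b)]
    simp_rw [transport]
    rw [ih, show s + 1 + r + 1 = s + (r + 1) + 1 by ring]

lemma tsum_qIdx_qden (hq0 : 0 < q) (hq1 : q < 1) (hx0 : 0 ≤ x) (hx1 : x ≤ 1) (r : ℕ) :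
    ∑' n : qIdx (r + 1), (∏ j, ENNReal.ofReal (1 / qden q x (n.1 j))) *
        ENNReal.ofReal (qratio q (n.1 (Fin.last _))) =
      ∑' m, ENNReal.ofReal (qratio q (m + 1)) ^ (r + 1) *
        ENNReal.ofReal (1 / qden q x (m + 1)) := by
  have h := tsum_qIdx_connector hq0 hq1 hx0 hx1 r 0
  rw [zero_add] at h
  rw [← h]
  refine tsum_congr fun n => ?_
  congr 1
  have h1 := tsum_ofReal_connector hq0 hq1 hx0 hx1 (n.2.2 (Fin.last r)) 0
  rw [connector_zero_right hq0 hq1 hx0 hx1, ENNReal.ofReal_one, mul_one] at h1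
  rw [← h1]
  refine tsum_congr fun m => ?_
  rw [connector_comm, pow_zero, one_mul, zero_add]

lemma ofReal_one_div_qden (hq0 : 0 < q) (hq1 : q < 1) (hx0 : 0 ≤ x) (hx1 : x ≤ 1) {n : ℕ}
    (hn : 0 < n) :
    ENNReal.ofReal (1 / qden q x n) = ∑' e : ℕ, ENNReal.ofReal x ^ e *
      (ENNReal.ofReal (1 / qnum q n) * ENNReal.ofReal (qratio q n) ^ e) := by
  have hw := qratio_nonneg hq0 hq1 n
  have hA := (qnum_pos hq0 hq1 hn)
  have hlt : x * qratio q n < 1 := by nlinarith [qratio_le hq0 hq1 hn]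
  have hs := (hasSum_geometric_of_lt_one (mul_nonneg hx0 hw) hlt).mul_left (1 / qnum q n)
  have hd := (qden_pos hq0 hq1 hx0 hx1 hn).ne'
  have e : 1 / qden q x n = 1 / qnum q n * (1 - x * qratio q n)⁻¹ := by
    have e' : qden q x n = qnum q n * (1 - x * qratio q n) := by
      unfold qden qratio
      field_simp
    rw [e', one_div, one_div, mul_inv]
  rw [e, ← hs.tsum_eq, ENNReal.ofReal_tsum_of_nonneg (fun i => by positivity) hs.summable]
  refine tsum_congr fun i => ?_
  rw [← ENNReal.ofReal_pow hx0, ← ENNReal.ofReal_pow hw, ← ENNReal.ofReal_mul (by positivity),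
    ← ENNReal.ofReal_mul (by positivity), mul_pow]
  congr 1
  ring

/-- The term of the series, in terms of the excesses `e_j = k_j - 1` (`k_j - 2` for the last one). -/
noncomputable def excessTerm (q : ℝ) {r : ℕ} (e n : Fin (r + 1) → ℕ) : ℝ≥0∞ :=
  (∏ j, ENNReal.ofReal (1 / qnum q (n j)) * ENNReal.ofReal (qratio q (n j)) ^ e j) *
    ENNReal.ofReal (qratio q (n (Fin.last _)))

/-- The sum of all series of depth `r + 1` with total excess `N`. -/
noncomputable def excessSum (q : ℝ) (r N : ℕ) : ℝ≥0∞ :=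
  ∑' e : {e : Fin (r + 1) → ℕ // ∑ j, e j = N}, ∑' n : qIdx (r + 1), excessTerm q e.1 n.1

/-- The depth one series of weight `N + r + 2`. -/
noncomputable def depthOneSum (q : ℝ) (r N : ℕ) : ℝ≥0∞ :=
  ∑' m : ℕ, ENNReal.ofReal (1 / qnum q (m + 1)) * ENNReal.ofReal (qratio q (m + 1)) ^ (N + r + 1)

lemma tsum_excessSum (hq0 : 0 < q) (hq1 : q < 1) (hx0 : 0 ≤ x) (hx1 : x ≤ 1) (r : ℕ) :
    ∑' N, ENNReal.ofReal x ^ N * excessSum q r N =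
      ∑' n : qIdx (r + 1), (∏ j, ENNReal.ofReal (1 / qden q x (n.1 j))) *
        ENNReal.ofReal (qratio q (n.1 (Fin.last _))) := by
  have h1 : ∀ n : qIdx (r + 1), (∏ j, ENNReal.ofReal (1 / qden q x (n.1 j))) *
        ENNReal.ofReal (qratio q (n.1 (Fin.last _))) =
      ∑' e : Fin (r + 1) → ℕ, ENNReal.ofReal x ^ (∑ j, e j) * excessTerm q e n.1 := by
    intro n
    simp_rw [fun j => ofReal_one_div_qden hq0 hq1 hx0 hx1 (n.2.2 j)]
    rw [prod_tsum_eq_tsum_prod, ← ENNReal.tsum_mul_right]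
    refine tsum_congr fun e => ?_
    rw [Finset.prod_mul_distrib, Finset.prod_pow_eq_pow_sum, mul_assoc]
    rfl
  simp_rw [h1]
  rw [ENNReal.tsum_comm, ← (Equiv.sigmaFiberEquiv fun e : Fin (r + 1) → ℕ => ∑ j, e j).tsum_eq,
    ENNReal.tsum_sigma']
  refine tsum_congr fun N => ?_
  rw [excessSum, ← ENNReal.tsum_mul_left]
  refine tsum_congr fun e => ?_
  rw [← ENNReal.tsum_mul_left]
  refine tsum_congr fun n => ?_
  change _ = ENNReal.ofReal x ^ (∑ j, e.1 j) * excessTerm q e.1 n.1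
  rw [e.2]

lemma tsum_depthOneSum (hq0 : 0 < q) (hq1 : q < 1) (hx0 : 0 ≤ x) (hx1 : x ≤ 1) (r : ℕ) :
    ∑' N, ENNReal.ofReal x ^ N * depthOneSum q r N =
      ∑' m, ENNReal.ofReal (qratio q (m + 1)) ^ (r + 1) *
        ENNReal.ofReal (1 / qden q x (m + 1)) := by
  simp_rw [fun m => ofReal_one_div_qden hq0 hq1 hx0 hx1 (Nat.succ_pos m), depthOneSum,
    ← ENNReal.tsum_mul_left]
  rw [ENNReal.tsum_comm]
  refine tsum_congr fun m => tsum_congr fun N => ?_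
  ring

lemma tsum_depthOneSum_ne_top (hq0 : 0 < q) (hq1 : q < 1) (r : ℕ) :
    ∑' N, depthOneSum q r N ≠ ⊤ := by
  have h := tsum_depthOneSum hq0 hq1 zero_le_one le_rfl r
  simp only [ENNReal.ofReal_one, one_pow, one_mul] at h
  rw [h]
  have hs : Summable fun m : ℕ => q ^ (m + 1) * (1 / (1 - q)) :=
    ((summable_nat_add_iff 1).2 (summable_geometric_of_lt_one hq0.le hq1)).mul_right _
  refine ne_top_of_le_ne_top hs.tsum_ofReal_ne_top (ENNReal.tsum_le_tsum fun m => ?_)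
  have hw := qratio_nonneg hq0 hq1 (m + 1)
  have hd := one_sub_le_qden hq0 hq1 zero_le_one le_rfl m.succ_pos
  have h1 : 0 < 1 - q := sub_pos.2 hq1
  rw [← ENNReal.ofReal_pow hw, ← ENNReal.ofReal_mul (by positivity)]
  refine ENNReal.ofReal_le_ofReal (mul_le_mul ?_ (one_div_le_one_div_of_le h1 hd)
    (one_div_nonneg.2 (h1.le.trans hd)) (by positivity))
  exact (pow_le_of_le_one hw ((qratio_le hq0 hq1 m.succ_pos).trans hq1.le) r.succ_ne_zero).trans
    (qratio_le_pow hq0 hq1 m.succ_pos)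

/-- Real power series that agree on `(0, 1)` and converge absolutely at `1` have equal
coefficients. -/
lemma eq_of_tsum_pow_mul_eq {a b : ℕ → ℝ≥0∞} (ha : ∑' N, a N ≠ ⊤) (hb : ∑' N, b N ≠ ⊤)
    (h : ∀ x : ℝ, 0 < x → x < 1 →
      ∑' N, ENNReal.ofReal x ^ N * a N = ∑' N, ENNReal.ofReal x ^ N * b N) : a = b := by
  have toReal_tsum : ∀ c : ℕ → ℝ≥0∞, ∑' N, c N ≠ ⊤ → ∀ x : ℝ, 0 < x →
      (∑' N, ENNReal.ofReal x ^ N * c N).toReal = ∑' N, x ^ N * (c N).toReal := by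
    intro c hc x hx
    rw [ENNReal.tsum_toReal_eq fun N =>
      ENNReal.mul_ne_top (by finiteness) (ENNReal.ne_top_of_tsum_ne_top hc N)]
    simp [ENNReal.toReal_ofReal hx.le]
  have hsa := ENNReal.summable_toReal ha
  have hsb := ENNReal.summable_toReal hb
  have hpow : ∀ c : ℕ → ℝ, Summable c → (∀ N, 0 ≤ c N) → ∀ x : ℝ, |x| ≤ 1 →
      Summable fun N => x ^ N * c N := fun c hc hc0 x hx =>
    hc.of_norm_bounded fun N => by
      rw [norm_mul, norm_pow, Real.norm_eq_abs, Real.norm_eq_abs, abs_of_nonneg (hc0 N)]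
      exact mul_le_of_le_one_left (hc0 N) (pow_le_one₀ (abs_nonneg x) hx)
  set d : ℕ → ℝ := fun N => (a N).toReal - (b N).toReal with hd
  set p := FormalMultilinearSeries.ofScalars ℝ d with hp
  have hsum : ∀ x : ℝ, |x| ≤ 1 → HasSum (fun N => x ^ N * d N)
      (∑' N, x ^ N * (a N).toReal - ∑' N, x ^ N * (b N).toReal) := fun x hx => by
    simpa only [hd, mul_sub] using (hpow _ hsa (fun _ => ENNReal.toReal_nonneg) x hx).hasSum.sub
      (hpow _ hsb (fun _ => ENNReal.toReal_nonneg) x hx).hasSum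
  have hfp : HasFPowerSeriesAt
      (fun x : ℝ => ∑' N, x ^ N * (a N).toReal - ∑' N, x ^ N * (b N).toReal) p 0 := by
    rw [hasFPowerSeriesAt_iff]
    filter_upwards [Metric.ball_mem_nhds (0 : ℝ) one_pos] with z hz
    rw [Metric.mem_ball, dist_zero_right, Real.norm_eq_abs] at hz
    simpa [hp, FormalMultilinearSeries.coeff_ofScalars] using hsum z hz.le
  have hp0 : p = 0 := by
    by_contra hne
    have hev := (hfp.locally_ne_zero hne).filter_mono (nhdsWithin_mono (0 : ℝ)
      fun z (hz : z ∈ Set.Ioi 0) => ne_of_gt hz)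
    have hlt : ∀ᶠ z : ℝ in 𝓝[>] 0, z ∈ Set.Ioo (0 : ℝ) 1 := Ioo_mem_nhdsGT one_pos
    obtain ⟨z, hz, hz0, hz1⟩ := (hev.and hlt).exists
    apply hz
    rw [← toReal_tsum a ha z hz0, ← toReal_tsum b hb z hz0, h z hz0 hz1, sub_self]
  funext N
  have hN : d N = 0 := by
    have := congrArg (fun P => FormalMultilinearSeries.coeff P N) hp0
    simp only [hp, FormalMultilinearSeries.coeff_ofScalars] at this
    exact this
  exact (ENNReal.toReal_eq_toReal_iff' (ENNReal.ne_top_of_tsum_ne_top ha N)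
    (ENNReal.ne_top_of_tsum_ne_top hb N)).1 (sub_eq_zero.1 hN)

lemma excessSum_eq_depthOneSum (hq0 : 0 < q) (hq1 : q < 1) (r N : ℕ) :
    excessSum q r N = depthOneSum q r N := by
  have h : ∀ x : ℝ, 0 ≤ x → x ≤ 1 → ∑' N, ENNReal.ofReal x ^ N * excessSum q r N =
      ∑' N, ENNReal.ofReal x ^ N * depthOneSum q r N := fun x hx0 hx1 => by
    rw [tsum_excessSum hq0 hq1 hx0 hx1, tsum_depthOneSum hq0 hq1 hx0 hx1,
      tsum_qIdx_qden hq0 hq1 hx0 hx1]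
  have h1 := h 1 zero_le_one le_rfl
  simp only [ENNReal.ofReal_one, one_pow, one_mul] at h1
  have hb := tsum_depthOneSum_ne_top hq0 hq1 r
  exact congrFun (eq_of_tsum_pow_mul_eq (h1 ▸ hb) hb fun x hx0 hx1 => h x hx0.le hx1.le) N

lemma depthOneSum_ne_top (hq0 : 0 < q) (hq1 : q < 1) (r N : ℕ) : depthOneSum q r N ≠ ⊤ :=
  ENNReal.ne_top_of_tsum_ne_top (tsum_depthOneSum_ne_top hq0 hq1 r) N

end GeneratingFunction

section Terms

variable {q : ℝ}

lemma cpow_div_cpow_qnum (hq0 : 0 < q) (hq1 : q < 1) {κ n : ℕ} (hκ : 1 ≤ κ) (hn : 0 < n) :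
    (q : ℂ) ^ (((κ : ℂ) - 1) * (n : ℂ)) / ((qnum q n : ℂ) ^ (κ : ℂ)) =
      ((1 / qnum q n * qratio q n ^ (κ - 1) : ℝ) : ℂ) := by
  obtain ⟨e, rfl⟩ := Nat.exists_eq_add_of_le' hκ
  have hA : (qnum q n : ℂ) ≠ 0 := Complex.ofReal_ne_zero.2 (qnum_pos hq0 hq1 hn).ne'
  have h1 : (((e + 1 : ℕ) : ℂ) - 1) * (n : ℂ) = ((e * n : ℕ) : ℂ) := by
    push_cast
    ring
  rw [h1, Complex.cpow_natCast, Complex.cpow_natCast, Nat.add_sub_cancel, qratio]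
  push_cast
  rw [div_pow, ← pow_mul, mul_comm e n]
  field_simp
  ring

lemma zetaTerm_eq (hq0 : 0 < q) (hq1 : q < 1) {r : ℕ} {κ : Fin r → ℕ} (hκ : ∀ j, 1 ≤ κ j)
    (n : qIdx r) :
    zetaTerm q (fun j => (κ j : ℂ)) n.1 =
      ((∏ j, 1 / qnum q (n.1 j) * qratio q (n.1 j) ^ (κ j - 1) : ℝ) : ℂ) := by
  unfold zetaTerm
  rw [Complex.ofReal_prod]
  exact Finset.prod_congr rfl fun j _ => cpow_div_cpow_qnum hq0 hq1 (hκ j) (n.2.2 j)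

/-- The exponents with given excesses. -/
def exponentOfExcess {r : ℕ} (e : Fin (r + 1) → ℕ) (j : Fin (r + 1)) : ℕ :=
  e j + 1 + if j = Fin.last r then 1 else 0

lemma sum_exponentOfExcess {r : ℕ} (e : Fin (r + 1) → ℕ) :
    ∑ j, exponentOfExcess e j = ∑ j, e j + r + 2 := by
  simp [exponentOfExcess, Finset.sum_add_distrib]
  ring

/-- The excesses of given exponents. -/
def excessOfExponent {r : ℕ} (κ : Fin (r + 1) → ℕ) (j : Fin (r + 1)) : ℕ :=
  κ j - 1 - if j = Fin.last r then 1 else 0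

lemma exponentOfExcess_excessOfExponent {r : ℕ} {κ : Fin (r + 1) → ℕ} (h1 : ∀ j, 1 ≤ κ j)
    (h2 : 2 ≤ κ (Fin.last r)) : exponentOfExcess (excessOfExponent κ) = κ := by
  funext j
  have hj := h1 j
  unfold exponentOfExcess excessOfExponent
  split_ifs with h
  · subst h
    omega
  · omega

/-- Exponents of weight `N + r + 2` correspond to excesses of total `N`. -/
def excessEquiv (r N : ℕ) : {e : Fin (r + 1) → ℕ // ∑ j, e j = N} ≃
    {κ : Fin (r + 1) → ℕ // (∀ j, 1 ≤ κ j) ∧ (∑ j, κ j) = N + r + 2 ∧ 2 ≤ κ (Fin.last r)} where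
  toFun e := ⟨exponentOfExcess e.1, fun j => by unfold exponentOfExcess; omega,
    by rw [sum_exponentOfExcess, e.2], by simp [exponentOfExcess]⟩
  invFun κ := ⟨excessOfExponent κ.1, by
    have h := sum_exponentOfExcess (excessOfExponent κ.1)
    rw [exponentOfExcess_excessOfExponent κ.2.1 κ.2.2.2, κ.2.2.1] at h
    omega⟩
  left_inv e := Subtype.ext (funext fun j => by
    simp only [exponentOfExcess, excessOfExponent]
    omega)
  right_inv κ := Subtype.ext (exponentOfExcess_excessOfExponent κ.2.1 κ.2.2.2)

lemma zetaTerm_exponentOfExcess (hq0 : 0 < q) (hq1 : q < 1) {r : ℕ} (e : Fin (r + 1) → ℕ)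
    (n : qIdx (r + 1)) :
    zetaTerm q (fun j => (exponentOfExcess e j : ℂ)) n.1 = ((excessTerm q e n.1).toReal : ℂ) := by
  rw [zetaTerm_eq hq0 hq1 fun j => by unfold exponentOfExcess; omega]
  congr 1
  rw [excessTerm, ENNReal.toReal_mul, ENNReal.toReal_prod,
    ENNReal.toReal_ofReal (qratio_nonneg hq0 hq1 _), Fin.prod_univ_castSucc,
    Fin.prod_univ_castSucc (n := r)]
  simp only [ENNReal.toReal_mul, ENNReal.toReal_pow,
    ENNReal.toReal_ofReal (qratio_nonneg hq0 hq1 _),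
    ENNReal.toReal_ofReal (one_div_nonneg.2 (qnum_nonneg hq0 hq1 _)), exponentOfExcess]
  simp [pow_succ, Fin.castSucc_ne_last]
  ring

lemma zetaTerm_depth_one (hq0 : 0 < q) (hq1 : q < 1) (r N i : ℕ) :
    zetaTerm q (fun _ => ((N + r + 2 : ℕ) : ℂ)) (qIdxOneEquiv i).1 =
      ((ENNReal.ofReal (1 / qnum q (i + 1)) *
        ENNReal.ofReal (qratio q (i + 1)) ^ (N + r + 1)).toReal : ℂ) := by
  rw [zetaTerm_eq hq0 hq1 (κ := fun _ => N + r + 2) (fun _ => by omega), ENNReal.toReal_mul,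
    ENNReal.toReal_pow, ENNReal.toReal_ofReal (qratio_nonneg hq0 hq1 _),
    ENNReal.toReal_ofReal (one_div_nonneg.2 (qnum_nonneg hq0 hq1 _)), Fin.prod_univ_one]
  rfl

end Terms

/-- Sum formula for `q`-multiple zeta values: for `1 ≤ r ≤ k − 1` (here depth `r + 1`
with `r + 2 ≤ k`), the sum of `ζ_q(k₁,…,k_{r+1})` over all positive integer tuples with
`k₁ + ⋯ + k_{r+1} = k` and `k_{r+1} ≥ 2` equals `ζ_q(k)`; all the series involved
converge absolutely. -/
theorem sum_formula_qMZV (q : ℝ) (hq0 : 0 < q) (hq1 : q < 1)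
    (k r : ℕ) (hk : r + 2 ≤ k) :
    (∀ κ : Fin (r + 1) → ℕ, (∀ j, 1 ≤ κ j) → (∑ j, κ j) = k → 2 ≤ κ (Fin.last r) →
      Summable (fun n : qIdx (r + 1) => zetaTerm q (fun j => (κ j : ℂ)) n.1)) ∧
    Summable (fun n : qIdx 1 => zetaTerm q (fun _ => (k : ℂ)) n.1) ∧
    ∑' κ : {κ : Fin (r + 1) → ℕ //
        (∀ j, 1 ≤ κ j) ∧ (∑ j, κ j) = k ∧ 2 ≤ κ (Fin.last r)},
        ∑' n : qIdx (r + 1), zetaTerm q (fun j => ((κ.1 j : ℕ) : ℂ)) n.1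
      = ∑' n : qIdx 1, zetaTerm q (fun _ => (k : ℂ)) n.1 := by
  obtain ⟨N, rfl⟩ : ∃ N, k = N + r + 2 := ⟨k - (r + 2), by omega⟩
  have hfin := depthOneSum_ne_top hq0 hq1 r N
  have hsum_eq := excessSum_eq_depthOneSum hq0 hq1 r N
  have hfin' : excessSum q r N ≠ ⊤ := hsum_eq ▸ hfin
  have hrow : ∀ e : {e : Fin (r + 1) → ℕ // ∑ j, e j = N},
      ∑' n : qIdx (r + 1), excessTerm q e.1 n.1 ≠ ⊤ := ENNReal.ne_top_of_tsum_ne_top hfin'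
  refine ⟨fun κ h1 h2 h3 => ?_, ?_, ?_⟩
  · obtain ⟨e, he⟩ := (excessEquiv r N).surjective ⟨κ, h1, h2, h3⟩
    have hκ : κ = exponentOfExcess e.1 := (congrArg Subtype.val he).symm
    subst hκ
    simp_rw [zetaTerm_exponentOfExcess hq0 hq1]
    exact Complex.ofRealCLM.summable (ENNReal.summable_toReal (hrow e))
  · rw [← qIdxOneEquiv.summable_iff]
    refine (Complex.ofRealCLM.summable (ENNReal.summable_toReal hfin)).congr fun i => ?_
    exact (zetaTerm_depth_one hq0 hq1 r N i).symm
  · rw [← (excessEquiv r N).tsum_eq, ← qIdxOneEquiv.tsum_eq]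
    simp_rw [zetaTerm_depth_one hq0 hq1]
    calc _ = ∑' e : {e : Fin (r + 1) → ℕ // ∑ j, e j = N},
          ∑' n : qIdx (r + 1), ((excessTerm q e.1 n.1).toReal : ℂ) :=
          tsum_congr fun e => tsum_congr fun n => zetaTerm_exponentOfExcess hq0 hq1 e.1 n
      _ = ((excessSum q r N).toReal : ℂ) := by
          simp_rw [← Complex.ofReal_tsum]
          rw [excessSum, ENNReal.tsum_toReal_eq hrow]
          simp_rw [fun e : {e : Fin (r + 1) → ℕ // ∑ j, e j = N} =>
            ENNReal.tsum_toReal_eq (ENNReal.ne_top_of_tsum_ne_top (hrow e))]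
      _ = _ := by
          rw [hsum_eq, ← Complex.ofReal_tsum, depthOneSum,
            ENNReal.tsum_toReal_eq (ENNReal.ne_top_of_tsum_ne_top hfin)]
end

section
/- For every s ∈ ℂ with Re(s) > 2, the series Σ_{n=0}^∞ (ζ_q(s−n−2, n+2) − ζ_q(−n, s+n)) converges and equals ζ_q(s); here each ζ_q of depth 2 is given by its double series, which converges absolutely for every n ≥ 0 when Re(s) > 2. -/
open Complex

/-- The general term of the depth-2 `q`-multiple zeta series `ζ_q(s₁,s₂)`. -/
noncomputable def zterm2 (q : ℝ) (s₁ s₂ : ℂ) (p : ℕ × ℕ) : ℂ :=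
  (q : ℂ) ^ ((s₁ - 1) * (p.1 : ℂ)) * (q : ℂ) ^ ((s₂ - 1) * (p.2 : ℂ)) /
    ((qnum q p.1 : ℂ) ^ s₁ * (qnum q p.2 : ℂ) ^ s₂)

/-- Pairs of integers `0 < n₁ < n₂`. -/
def I2 : Type := {p : ℕ × ℕ // 0 < p.1 ∧ p.1 < p.2}

/-- The depth-2 `q`-multiple zeta function, given by its double series. -/
noncomputable def zeta2 (q : ℝ) (s₁ s₂ : ℂ) : ℂ := ∑' p : I2, zterm2 q s₁ s₂ p.1

/-- The general term of the depth-1 `q`-zeta series `ζ_q(s)`. -/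
noncomputable def zterm1 (q : ℝ) (s : ℂ) (n : ℕ) : ℂ :=
  (q : ℂ) ^ ((s - 1) * (n : ℂ)) / (qnum q n : ℂ) ^ s

/-- The `q`-analogue `q ^ n / [n]_q` of `1 / n`. -/
noncomputable def qrecip (q : ℝ) (n : ℕ) : ℝ := (1 - q) * q ^ n / (1 - q ^ n)

/-- The Lambert-type term `q ^ (d + 1) / (1 - q ^ (d + 1))`. -/
noncomputable def lambertTerm (q : ℝ) (d : ℕ) : ℝ := q ^ (d + 1) / (1 - q ^ (d + 1))

/-- The kernel `∑ₖ u_n² q⁻ᵐ⁻ⁿ (u_n / u_m)ᵏ`, where `u` is `qrecip q`, in closed form. -/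
noncomputable def pairKernel (q : ℝ) (p : ℕ × ℕ) : ℝ :=
  qrecip q p.2 * ((1 - q) / (q ^ p.1 - q ^ p.2))

/-- The terms `u_n² q⁻ᵐ⁻ⁿ (u_n / u_m)ᵏ` of `pairKernel`. -/
noncomputable def pairKernelTerm (q : ℝ) (k : ℕ) (p : ℕ × ℕ) : ℝ :=
  qrecip q p.2 ^ 2 / (q ^ p.1 * q ^ p.2) * (qrecip q p.2 / qrecip q p.1) ^ k

/-- Pairs `0 < m < n` parametrized by `m - 1` and `n - m - 1`. -/
def prodEquivI2 : ℕ × ℕ ≃ I2 where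
  toFun x := ⟨(x.1 + 1, x.1 + 1 + (x.2 + 1)), by simp⟩
  invFun p := (p.1.1 - 1, p.1.2 - p.1.1 - 1)
  left_inv x := by ext <;> simp
  right_inv p := by
    obtain ⟨⟨m, n⟩, h₁, h₂⟩ := p
    apply Subtype.ext
    simp only at h₁ h₂
    ext <;> simp only <;> omega

/-- Pairs `0 < m < n` fibred over `n - 1`. -/
def sigmaEquivI2 : (Σ N : ℕ, Fin N) ≃ I2 where
  toFun x := ⟨(x.2.1 + 1, x.1 + 1), by simp⟩
  invFun p := ⟨p.1.2 - 1, ⟨p.1.1 - 1, by have := p.2; omega⟩⟩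
  left_inv x := by simp
  right_inv p := by
    obtain ⟨⟨m, n⟩, h₁, h₂⟩ := p
    apply Subtype.ext
    simp only at h₁ h₂
    ext <;> simp only <;> omega

section

variable {q : ℝ}

lemma qrecip_pos (hq0 : 0 < q) (hq1 : q < 1) {n : ℕ} (hn : 0 < n) : 0 < qrecip q n := by
  have h := pow_lt_one₀ hq0.le hq1 hn.ne'
  exact div_pos (mul_pos (by linarith) (by positivity)) (by linarith)

lemma qrecip_le_pow (hq0 : 0 < q) (hq1 : q < 1) {n : ℕ} (hn : 0 < n) :
    qrecip q n ≤ q ^ n := by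
  have h := pow_lt_one₀ hq0.le hq1 hn.ne'
  have h' : q ^ n ≤ q := pow_le_of_le_one hq0.le hq1.le hn.ne'
  rw [qrecip, div_le_iff₀ (by linarith), mul_comm]
  gcongr

lemma qrecip_lt_qrecip (hq0 : 0 < q) (hq1 : q < 1) {m n : ℕ} (hm : 0 < m) (hmn : m < n) :
    qrecip q n < qrecip q m := by
  have hm' := pow_lt_one₀ hq0.le hq1 hm.ne'
  have h : q ^ n < q ^ m := pow_lt_pow_right_of_lt_one₀ hq0 hq1 hmn
  rw [qrecip, qrecip, div_lt_div_iff₀ (by linarith) (by linarith)]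
  have : (1 - q) * q ^ n < (1 - q) * q ^ m := mul_lt_mul_of_pos_left h (by linarith)
  linarith

lemma zterm1_eq (hq0 : 0 < q) (hq1 : q < 1) (s : ℂ) {n : ℕ} (hn : 0 < n) :
    zterm1 q s n = (qrecip q n : ℂ) ^ s / (q : ℂ) ^ n := by
  have h := pow_lt_one₀ hq0.le hq1 hn.ne'
  have hq : (q : ℂ) ≠ 0 := by exact_mod_cast hq0.ne'
  have hnum : 0 ≤ qnum q n := div_nonneg (by linarith) (by linarith)
  have hu : qrecip q n = q ^ n / qnum q n := by
    have : 1 - q ^ n ≠ 0 := by linarith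
    have : 1 - q ≠ 0 := by linarith
    rw [qrecip, qnum]
    field_simp
  have hpow : ((q ^ n : ℝ) : ℂ) ^ s = (q : ℂ) ^ (s * n) := by
    have hqn : ((q ^ n : ℝ) : ℂ) ≠ 0 := by exact_mod_cast (pow_pos hq0 n).ne'
    rw [cpow_def_of_ne_zero hqn, cpow_def_of_ne_zero hq, ← ofReal_log (by positivity),
      ← ofReal_log hq0.le, Real.log_pow]
    push_cast
    ring_nf
  rw [hu, ofReal_div, Complex.div_cpow_ofReal_nonneg (by positivity) hnum, hpow, zterm1,
    sub_mul, one_mul, cpow_sub _ _ hq, cpow_natCast, div_right_comm]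

lemma zterm2_eq_mul (q : ℝ) (s₁ s₂ : ℂ) (p : ℕ × ℕ) :
    zterm2 q s₁ s₂ p = zterm1 q s₁ p.1 * zterm1 q s₂ p.2 := by
  rw [zterm2, zterm1, zterm1, div_mul_div_comm]

lemma pairKernelTerm_nonneg (hq0 : 0 < q) (hq1 : q < 1) (k : ℕ) (p : I2) :
    0 ≤ pairKernelTerm q k p.1 := by
  have hm := qrecip_pos hq0 hq1 p.2.1
  have hn := qrecip_pos hq0 hq1 (p.2.1.trans p.2.2)
  unfold pairKernelTerm
  positivity

lemma hasSum_pairKernelTerm (hq0 : 0 < q) (hq1 : q < 1) (p : I2) :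
    HasSum (fun k => pairKernelTerm q k p.1) (pairKernel q p.1) := by
  obtain ⟨⟨m, n⟩, h₁, h₂⟩ := p
  simp only at h₁ h₂
  have hm := qrecip_pos hq0 hq1 h₁
  have hn := qrecip_pos hq0 hq1 (h₁.trans h₂)
  have hlt := qrecip_lt_qrecip hq0 hq1 h₁ h₂
  have hgeo := (hasSum_geometric_of_lt_one (div_pos hn hm).le
    ((div_lt_one hm).2 hlt)).mul_left (qrecip q n ^ 2 / (q ^ m * q ^ n))
  suffices hK : pairKernel q (m, n) =
      qrecip q n ^ 2 / (q ^ m * q ^ n) * (1 - qrecip q n / qrecip q m)⁻¹ by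
    rw [hK]
    exact hgeo
  have hm' := pow_lt_one₀ hq0.le hq1 h₁.ne'
  have h : q ^ n < q ^ m := pow_lt_pow_right_of_lt_one₀ hq0 hq1 h₂
  have e₁ : 1 - q ^ m ≠ 0 := by linarith
  have e₂ : 1 - q ^ n ≠ 0 := by linarith
  have e₃ : q ^ m - q ^ n ≠ 0 := by linarith
  have e₄ : 1 - q ≠ 0 := by linarith
  have key : 1 - qrecip q n / qrecip q m = (q ^ m - q ^ n) / (q ^ m * (1 - q ^ n)) := by
    rw [qrecip, qrecip]
    field_simp
    ring
  rw [key, pairKernel]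
  simp only [qrecip]
  field_simp

lemma zterm2_left_eq (hq0 : 0 < q) (hq1 : q < 1) (s : ℂ) (k : ℕ) (p : I2) :
    zterm2 q (s - k - 2) ((k : ℂ) + 2) p.1 =
      (qrecip q p.1.1 : ℂ) ^ (s - 2) * (pairKernelTerm q k p.1 : ℂ) := by
  obtain ⟨⟨m, n⟩, h₁, h₂⟩ := p
  simp only at h₁ h₂
  have hm : (qrecip q m : ℂ) ≠ 0 := by exact_mod_cast (qrecip_pos hq0 hq1 h₁).ne'
  have hn : (qrecip q n : ℂ) ≠ 0 := by exact_mod_cast (qrecip_pos hq0 hq1 (h₁.trans h₂)).ne'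
  have hq : (q : ℂ) ≠ 0 := by exact_mod_cast hq0.ne'
  simp only [zterm2_eq_mul, zterm1_eq hq0 hq1 _ h₁, zterm1_eq hq0 hq1 _ (h₁.trans h₂)]
  rw [show s - k - 2 = s - 2 - k by ring, cpow_sub _ _ hm, cpow_add _ _ hn, cpow_natCast,
    cpow_natCast, cpow_ofNat, pairKernelTerm]
  push_cast
  rw [div_pow]
  field_simp

lemma zterm2_right_eq (hq0 : 0 < q) (hq1 : q < 1) (s : ℂ) (k : ℕ) (p : I2) :
    zterm2 q (-(k : ℂ)) (s + k) p.1 =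
      (qrecip q p.1.2 : ℂ) ^ (s - 2) * (pairKernelTerm q k p.1 : ℂ) := by
  obtain ⟨⟨m, n⟩, h₁, h₂⟩ := p
  simp only at h₁ h₂
  have hm : (qrecip q m : ℂ) ≠ 0 := by exact_mod_cast (qrecip_pos hq0 hq1 h₁).ne'
  have hn : (qrecip q n : ℂ) ≠ 0 := by exact_mod_cast (qrecip_pos hq0 hq1 (h₁.trans h₂)).ne'
  have hq : (q : ℂ) ≠ 0 := by exact_mod_cast hq0.ne'
  simp only [zterm2_eq_mul, zterm1_eq hq0 hq1 _ h₁, zterm1_eq hq0 hq1 _ (h₁.trans h₂)]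
  rw [show s + k = s - 2 + 2 + k by ring, cpow_add _ _ hn, cpow_add _ _ hn, cpow_neg,
    cpow_natCast, cpow_natCast, cpow_ofNat, pairKernelTerm]
  push_cast
  rw [div_pow]
  field_simp

lemma pairKernel_nonneg (hq0 : 0 < q) (hq1 : q < 1) (p : I2) : 0 ≤ pairKernel q p.1 :=
  (hasSum_pairKernelTerm hq0 hq1 p).nonneg fun k => pairKernelTerm_nonneg hq0 hq1 k p

lemma pairKernel_le_pow (hq0 : 0 < q) (hq1 : q < 1) {m : ℕ} (hm : 0 < m) (d : ℕ) :
    pairKernel q (m, m + (d + 1)) ≤ q ^ (d + 1) := by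
  have hd : q ^ (d + 1) ≤ q := pow_le_of_le_one hq0.le hq1.le d.succ_ne_zero
  have hu := qrecip_le_pow hq0 hq1 (show 0 < m + (d + 1) by omega)
  have hqm : 0 < q ^ m := by positivity
  rw [pairKernel]
  simp only
  rw [pow_add] at hu ⊢
  rw [← mul_one_sub, mul_div_assoc', div_le_iff₀ (mul_pos hqm (by linarith))]
  calc qrecip q (m + (d + 1)) * (1 - q)
      ≤ q ^ m * q ^ (d + 1) * (1 - q ^ (d + 1)) := by gcongr
    _ = _ := by ring

lemma summable_rpow_mul_pairKernel (hq0 : 0 < q) (hq1 : q < 1) {σ : ℝ} (hσ : 0 < σ) :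
    Summable fun p : I2 => qrecip q p.1.1 ^ σ * pairKernel q p.1 := by
  rw [← prodEquivI2.summable_iff]
  have h₁ : Summable fun i : ℕ => (q ^ σ) ^ (i + 1) :=
    (summable_nat_add_iff 1).2 (summable_geometric_of_lt_one (by positivity)
      (Real.rpow_lt_one hq0.le hq1 hσ))
  have h₂ : Summable fun d : ℕ => q ^ (d + 1) :=
    (summable_nat_add_iff 1).2 (summable_geometric_of_lt_one hq0.le hq1)
  refine Summable.of_nonneg_of_le (fun x => ?_) (fun x => ?_)
    (h₁.mul_of_nonneg h₂ (fun i => by positivity) (fun d => by positivity))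
  · exact mul_nonneg (Real.rpow_nonneg (qrecip_pos hq0 hq1 (prodEquivI2 x).2.1).le _)
      (pairKernel_nonneg hq0 hq1 _)
  · refine mul_le_mul ?_ (pairKernel_le_pow hq0 hq1 x.1.succ_pos x.2)
      (pairKernel_nonneg hq0 hq1 (prodEquivI2 x)) (by positivity)
    rw [← Real.rpow_mul_natCast hq0.le, mul_comm σ, Real.rpow_natCast_mul hq0.le]
    exact Real.rpow_le_rpow (qrecip_pos hq0 hq1 x.1.succ_pos).le
      (qrecip_le_pow hq0 hq1 x.1.succ_pos) hσ.le

lemma summable_lambertTerm (hq0 : 0 < q) (hq1 : q < 1) : Summable (lambertTerm q) := by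
  have h : Summable fun d : ℕ => q ^ (d + 1) / (1 - q) :=
    ((summable_nat_add_iff 1).2 (summable_geometric_of_lt_one hq0.le hq1)).div_const _
  have hd (d : ℕ) : q ^ (d + 1) ≤ q := pow_le_of_le_one hq0.le hq1.le d.succ_ne_zero
  refine Summable.of_nonneg_of_le (fun d => ?_) (fun d => ?_) h
  · exact div_nonneg (by positivity) (by linarith [hd d])
  · exact div_le_div_of_nonneg_left (by positivity) (by linarith) (by linarith [hd d])

lemma hasSum_pairKernel_right (hq0 : 0 < q) (hq1 : q < 1) {m : ℕ} (hm : 0 < m) :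
    HasSum (fun d => pairKernel q (m, m + (d + 1)))
      ((1 - q) ^ 2 / (1 - q ^ m) * ∑ d ∈ Finset.range m, lambertTerm q d) := by
  have hg := (summable_lambertTerm hq0 hq1).hasSum
  have h := (hg.sub ((hasSum_nat_add_iff' m).2 hg)).mul_left ((1 - q) ^ 2 / (1 - q ^ m))
  rw [sub_sub_cancel] at h
  refine h.congr_fun ?_
  intro d
  have h₁ := pow_lt_one₀ hq0.le hq1 hm.ne'
  have h₂ := pow_lt_one₀ hq0.le hq1 d.succ_ne_zero
  have h₃ := pow_lt_one₀ hq0.le hq1 (show m + (d + 1) ≠ 0 by omega)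
  have hqm : 0 < q ^ m := by positivity
  simp only [pairKernel, qrecip, lambertTerm]
  rw [show d + m + 1 = m + (d + 1) by ring]
  rw [pow_add] at h₃ ⊢
  rw [← mul_one_sub (q ^ m)]
  generalize q ^ (d + 1) = y at *
  generalize q ^ m = x at *
  have e₁ : 1 - x ≠ 0 := by linarith
  have e₂ : 1 - y ≠ 0 := by linarith
  have e₃ : 1 - x * y ≠ 0 := by linarith
  field_simp
  ring

lemma sum_pairKernel_left (hq0 : 0 < q) (hq1 : q < 1) (N : ℕ) :
    ∑ j : Fin N, pairKernel q (j + 1, N + 1) =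
      (1 - q) ^ 2 / (1 - q ^ (N + 1)) * ∑ d ∈ Finset.range N, lambertTerm q d := by
  rw [Fin.sum_univ_eq_sum_range (fun j => pairKernel q (j + 1, N + 1)), Finset.mul_sum,
    ← Finset.sum_range_reflect]
  refine Finset.sum_congr rfl fun d hd => ?_
  obtain ⟨m, rfl⟩ : ∃ m, N = d + 1 + m := Nat.exists_eq_add_of_le (Finset.mem_range.1 hd)
  have h₂ := pow_lt_one₀ hq0.le hq1 d.succ_ne_zero
  have h₃ := pow_lt_one₀ hq0.le hq1 (show (m + 1) + (d + 1) ≠ 0 by omega)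
  have hqm : 0 < q ^ (m + 1) := by positivity
  simp only [pairKernel, qrecip, lambertTerm]
  rw [show d + 1 + m - 1 - d + 1 = m + 1 by omega,
    show d + 1 + m + 1 = (m + 1) + (d + 1) by ring]
  rw [pow_add _ (m + 1)] at h₃ ⊢
  rw [← mul_one_sub (q ^ (m + 1))]
  simp only [Nat.succ_eq_add_one] at h₂
  generalize q ^ (d + 1) = y at *
  generalize q ^ (m + 1) = x at *
  have e₂ : 1 - y ≠ 0 := by linarith
  have e₃ : 1 - x * y ≠ 0 := by linarith
  field_simp

end

/-- Summing `z p * c k p` over `k` and then over `p` or in the other order gives the same result,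
when `c` is nonnegative. -/
lemma hasSum_tsum_mul_of_nonneg {ι : Type*} {z : ι → ℂ} {c : ℕ → ι → ℝ} {C : ι → ℝ}
    (hc : ∀ k p, 0 ≤ c k p) (hC : ∀ p, HasSum (fun k => c k p) (C p))
    (hz : Summable fun p => ‖z p‖ * C p) :
    (∀ k, Summable fun p => z p * (c k p : ℂ)) ∧
      HasSum (fun k => ∑' p, z p * (c k p : ℂ)) (∑' p, z p * (C p : ℂ)) := by
  have hp (p : ι) : HasSum (fun k => z p * (c k p : ℂ)) (z p * (C p : ℂ)) :=
    (Complex.hasSum_ofReal.2 (hC p)).mul_left _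
  have hn (p : ι) : HasSum (fun k => ‖z p * (c k p : ℂ)‖) (‖z p‖ * C p) := by
    simpa [abs_of_nonneg (hc _ p)] using (hC p).mul_left ‖z p‖
  have hprod : Summable fun x : ι × ℕ => z x.1 * (c x.2 x.1 : ℂ) := by
    refine Summable.of_norm ((summable_prod_of_nonneg fun x => norm_nonneg _).2
      ⟨fun p => (hn p).summable, ?_⟩)
    simpa only [(hn _).tsum_eq] using hz
  have hfib := hprod.prod_symm.prod_factor
  refine ⟨hfib, ?_⟩
  have h₁ := hprod.hasSum.prod_fiberwise hp
  rw [h₁.tsum_eq]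
  exact ((Equiv.prodComm ℕ ι).hasSum_iff.2 hprod.hasSum).prod_fiberwise fun k => (hfib k).hasSum

/-- For `Re(s) > 2`, the series `Σ_{n=0}^∞ (ζ_q(s−n−2, n+2) − ζ_q(−n, s+n))` converges and
equals `ζ_q(s)`; each depth-2 `q`-multiple zeta value is given by its double series, which
converges absolutely for every `n ≥ 0`. -/
theorem qzeta_sum_formula_interpolated_re_gt_two (q : ℝ) (hq0 : 0 < q) (hq1 : q < 1)
    (s : ℂ) (hs : 2 < s.re) :
    (∀ n : ℕ, Summable (fun p : I2 => zterm2 q (s - n - 2) ((n : ℂ) + 2) p.1) ∧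
      Summable (fun p : I2 => zterm2 q (-(n : ℂ)) (s + n) p.1)) ∧
    HasSum (fun n : ℕ => zeta2 q (s - n - 2) ((n : ℂ) + 2) - zeta2 q (-(n : ℂ)) (s + n))
      (∑' n : {n : ℕ // 0 < n}, zterm1 q s n.1) := by
  have hσ : 0 < (s - 2).re := by simpa using hs
  have hnorm {n : ℕ} (hn : 0 < n) :
      ‖(qrecip q n : ℂ) ^ (s - 2)‖ = qrecip q n ^ (s - 2).re :=
    norm_cpow_eq_rpow_re_of_pos (qrecip_pos hq0 hq1 hn) _
  have hA₀ : Summable fun p : I2 => ‖(qrecip q p.1.1 : ℂ) ^ (s - 2)‖ * pairKernel q p.1 := by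
    refine (summable_rpow_mul_pairKernel hq0 hq1 hσ).congr fun p => ?_
    rw [hnorm p.2.1]
  have hB₀ : Summable fun p : I2 => ‖(qrecip q p.1.2 : ℂ) ^ (s - 2)‖ * pairKernel q p.1 := by
    refine hA₀.of_nonneg_of_le (fun p => mul_nonneg (norm_nonneg _) (pairKernel_nonneg hq0 hq1 p))
      fun p => mul_le_mul_of_nonneg_right ?_ (pairKernel_nonneg hq0 hq1 p)
    rw [hnorm p.2.1, hnorm (p.2.1.trans p.2.2)]
    exact Real.rpow_le_rpow (qrecip_pos hq0 hq1 (p.2.1.trans p.2.2)).le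
      (qrecip_lt_qrecip hq0 hq1 p.2.1 p.2.2).le hσ.le
  obtain ⟨hA, hA'⟩ := hasSum_tsum_mul_of_nonneg (pairKernelTerm_nonneg hq0 hq1)
    (hasSum_pairKernelTerm hq0 hq1) hA₀
  obtain ⟨hB, hB'⟩ := hasSum_tsum_mul_of_nonneg (pairKernelTerm_nonneg hq0 hq1)
    (hasSum_pairKernelTerm hq0 hq1) hB₀
  simp only [zeta2, zterm2_left_eq hq0 hq1, zterm2_right_eq hq0 hq1]
  refine ⟨fun k => ⟨hA k, hB k⟩, ?_⟩
  have hSA : Summable fun p : I2 => (qrecip q p.1.1 : ℂ) ^ (s - 2) * (pairKernel q p.1 : ℂ) :=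
    Summable.of_norm <| hA₀.congr fun p => by simp [abs_of_nonneg (pairKernel_nonneg hq0 hq1 p)]
  have hSB : Summable fun p : I2 => (qrecip q p.1.2 : ℂ) ^ (s - 2) * (pairKernel q p.1 : ℂ) :=
    Summable.of_norm <| hB₀.congr fun p => by simp [abs_of_nonneg (pairKernel_nonneg hq0 hq1 p)]
  have hfA := (prodEquivI2.hasSum_iff.2 hSA.hasSum).prod_fiberwise fun i =>
    (Complex.hasSum_ofReal.2 (hasSum_pairKernel_right hq0 hq1 i.succ_pos)).mul_left
      ((qrecip q (i + 1) : ℂ) ^ (s - 2))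
  have hfB := (sigmaEquivI2.hasSum_iff.2 hSB.hasSum).sigma fun N => hasSum_fintype _
  have hAB := hA'.sub hB'
  rw [← (hfA.sub hfB).tsum_eq] at hAB
  suffices hval : ∑' n : {n : ℕ // 0 < n}, zterm1 q s n.1 = _ by
    rw [hval]
    exact hAB
  let e : ℕ ≃ {n : ℕ // 0 < n} := Equiv.pnatEquivNat.symm
  rw [← e.tsum_eq]
  refine tsum_congr fun i => ?_
  have hu : (qrecip q (i + 1) : ℂ) ≠ 0 := by exact_mod_cast (qrecip_pos hq0 hq1 i.succ_pos).ne'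
  have hsum : ∑ j : Fin i, ((fun p : I2 => (qrecip q p.1.2 : ℂ) ^ (s - 2) *
      (pairKernel q p.1 : ℂ)) ∘ sigmaEquivI2) ⟨i, j⟩ = (qrecip q (i + 1) : ℂ) ^ (s - 2) *
        ((∑ j : Fin i, pairKernel q (j + 1, i + 1) : ℝ) : ℂ) := by
    rw [ofReal_sum, Finset.mul_sum]
    rfl
  rw [hsum, sum_pairKernel_left hq0 hq1, ← mul_sub, ← ofReal_sub, ← mul_sub]
  change zterm1 q s (i + 1) = _
  rw [Nat.succ_eq_add_one, Finset.sum_range_succ, add_sub_cancel_left,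
    zterm1_eq hq0 hq1 s i.succ_pos, show s = s - 2 + 2 by ring, cpow_add _ _ hu, cpow_ofNat,
    add_sub_cancel_right, mul_div_assoc]
  congr 1
  norm_cast
  rw [qrecip, lambertTerm]
  have h₁ := pow_lt_one₀ hq0.le hq1 i.succ_ne_zero
  have e₁ : 1 - q ^ (i + 1) ≠ 0 := by simp only [Nat.succ_eq_add_one] at h₁; linarith
  field_simp
end

section
/- Let 𝔖 = {(s₁,s₂) ∈ ℂ² : s₂ ∈ 1+(2πi/log q)ℤ, or s₂ ∈ ℤ_{≤0}+(2πi/log q)(ℤ∖{0}), or s₁+s₂ ∈ ℤ_{≤2}+(2πi/log q)ℤ}, and suppose Z : ℂ²∖𝔖 → ℂ is holomorphic and satisfies Z(s₁,s₂) = Σ_{0<n₁<n₂} q^{(s₁−1)n₁+(s₂−1)n₂}/([n₁]_q^{s₁}[n₂]_q^{s₂}) whenever Re(s₂) > 1 and Re(s₁+s₂) > 2. Then for every s ∈ ℂ with Re(s) > 1 and s ∉ 2+(2πi/log q)ℤ, the series Σ_{n=0}^∞ (Z(s−n−2, n+2) − Z(−n, s+n)) converges and equals ζ_q(s). -/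
open Complex

/-- The singular set `𝔖` of the depth-2 `q`-multiple zeta function. -/
def badSet (q : ℝ) : Set (ℂ × ℂ) :=
  {p | (∃ m : ℤ, p.2 = 1 + 2 * (Real.pi : ℂ) * Complex.I / (Real.log q : ℂ) * m) ∨
    (∃ k : ℤ, k ≤ 0 ∧ ∃ m : ℤ, m ≠ 0 ∧
      p.2 = (k : ℂ) + 2 * (Real.pi : ℂ) * Complex.I / (Real.log q : ℂ) * m) ∨
    (∃ k : ℤ, k ≤ 2 ∧ ∃ m : ℤ,
      p.1 + p.2 = (k : ℂ) + 2 * (Real.pi : ℂ) * Complex.I / (Real.log q : ℂ) * m)}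

/-- The normalised `q`-number `1 - q^(i+1)`, indexed from `0`. -/
noncomputable def qgap (q : ℝ) (i : ℕ) : ℝ := 1 - q ^ (i + 1)

/-- The quotient of two normalised `q`-numbers at distance `j + 1`. -/
noncomputable def qrat (q : ℝ) (i j : ℕ) : ℝ := qgap q i / qgap q (i + j + 1)

/-- The exponential variable `q^(s-2)`. -/
noncomputable def qx (q : ℝ) (s : ℂ) : ℂ := (q : ℂ) ^ (s - 2)

/-- The double geometric family `(t q^n)^(j+1)`. -/
noncomputable def geo (q : ℝ) (t : ℂ) (p : ℕ × ℕ) : ℂ := (t * (q : ℂ) ^ p.1) ^ (p.2 + 1)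

/-- The weight of the terms of `ζ_q(s-n-2, n+2)` relative to their geometric part. -/
noncomputable def weightL (q : ℝ) (s : ℂ) (p : ℕ × ℕ × ℕ) : ℂ :=
  (qgap q p.2.1 : ℂ) ^ (-s) * (qrat q p.2.1 p.2.2 : ℂ) ^ (p.1 + 2)

/-- The weight of the terms of `ζ_q(-n, s+n)` relative to their geometric part. -/
noncomputable def weightR (q : ℝ) (s : ℂ) (p : ℕ × ℕ × ℕ) : ℂ :=
  (qgap q (p.2.1 + p.2.2 + 1) : ℂ) ^ (-s) * (qrat q p.2.1 p.2.2 : ℂ) ^ p.1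

/-- The triple family with geometric part given by `x`, `t` and weight `w`. -/
noncomputable def wterm (q : ℝ) (x t : ℂ) (w : ℕ × ℕ × ℕ → ℂ) (p : ℕ × ℕ × ℕ) : ℂ :=
  x ^ (p.2.1 + 1) * geo q t (p.1, p.2.2) * w p

/-- The dominating family for the regularised triple series. -/
noncomputable def domFam (q ρ C : ℝ) (p : ℕ × ℕ × ℕ) : ℝ :=
  C * ((((p.1 : ℝ) + 3) * q ^ p.1) * (ρ ^ (p.2.1 + 1) * ρ ^ (p.2.2 + 1)))

lemma qgap_lower {q : ℝ} (hq0 : 0 < q) (hq1 : q < 1) (i : ℕ) : 1 - q ≤ qgap q i := by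
  have := pow_le_of_le_one hq0.le hq1.le (show i + 1 ≠ 0 by omega)
  simp only [qgap]; linarith

lemma qgap_pos {q : ℝ} (hq0 : 0 < q) (hq1 : q < 1) (i : ℕ) : 0 < qgap q i := by
  linarith [qgap_lower hq0 hq1 i]

lemma qgap_le_one {q : ℝ} (hq0 : 0 < q) (i : ℕ) : qgap q i ≤ 1 := by
  have : 0 < q ^ (i + 1) := by positivity
  simp only [qgap]; linarith

lemma qgap_mono {q : ℝ} (hq0 : 0 < q) (hq1 : q < 1) (i j : ℕ) :
    qgap q i ≤ qgap q (i + j + 1) := by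
  have := pow_le_pow_of_le_one hq0.le hq1.le (show i + 1 ≤ i + j + 1 + 1 by omega)
  simp only [qgap]; linarith

lemma qrat_nonneg {q : ℝ} (hq0 : 0 < q) (hq1 : q < 1) (i j : ℕ) : 0 ≤ qrat q i j :=
  div_nonneg (qgap_pos hq0 hq1 _).le (qgap_pos hq0 hq1 _).le

lemma qrat_le_one {q : ℝ} (hq0 : 0 < q) (hq1 : q < 1) (i j : ℕ) : qrat q i j ≤ 1 :=
  div_le_one_of_le₀ (qgap_mono hq0 hq1 i j) (qgap_pos hq0 hq1 _).le

lemma one_sub_qrat_le {q : ℝ} (hq0 : 0 < q) (hq1 : q < 1) (i j : ℕ) :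
    1 - qrat q i j ≤ q ^ (i + 1) / (1 - q) := by
  have hv := qgap_pos hq0 hq1 (i + j + 1)
  have h1 : 1 - qrat q i j = (qgap q (i + j + 1) - qgap q i) / qgap q (i + j + 1) := by
    rw [qrat, sub_div, div_self hv.ne']
  rw [h1]
  have hq : 0 < 1 - q := by linarith
  refine div_le_div₀ (by positivity) ?_ hq (qgap_lower hq0 hq1 _)
  have := qgap_le_one hq0 (i + j + 1)
  simp only [qgap] at this ⊢
  linarith

lemma norm_exp_sub_one_le_mul_exp (z : ℂ) : ‖exp z - 1‖ ≤ ‖z‖ * Real.exp ‖z‖ := by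
  simpa using Complex.norm_exp_sub_sum_le_norm_mul_exp z 1

/-- Complex powers of a real base near `1` are close to `1`, uniformly in bounded exponents. -/
lemma norm_cpow_neg_sub_one_le {c w R : ℝ} {s : ℂ} (hc : 0 < c) (hw : c ≤ w) (hw1 : w ≤ 1)
    (hs : ‖s‖ ≤ R) :
    ‖(w : ℂ) ^ (-s) - 1‖ ≤ R / c * Real.exp (R / c) * (1 - w) := by
  have hwpos : 0 < w := hc.trans_le hw
  have hR : 0 ≤ R := (norm_nonneg s).trans hs
  have hlog : |Real.log w| ≤ (1 - w) / c := by
    rw [abs_of_nonpos (Real.log_nonpos hwpos.le hw1)]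
    have h1 := Real.one_sub_inv_le_log_of_pos hwpos
    have h2 : w⁻¹ - 1 = (1 - w) / w := by field_simp
    have h3 : (1 - w) / w ≤ (1 - w) / c :=
      div_le_div_of_nonneg_left (by linarith) hc hw
    linarith
  have hz : ‖Complex.log (w : ℂ) * (-s)‖ ≤ R / c * (1 - w) := by
    rw [norm_mul, norm_neg, ← Complex.ofReal_log hwpos.le, Complex.norm_real, Real.norm_eq_abs]
    calc |Real.log w| * ‖s‖ ≤ (1 - w) / c * R :=
          mul_le_mul hlog hs (norm_nonneg _) (div_nonneg (by linarith) hc.le)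
      _ = R / c * (1 - w) := by ring
  have hz' : ‖Complex.log (w : ℂ) * (-s)‖ ≤ R / c :=
    hz.trans (mul_le_of_le_one_right (by positivity) (by linarith))
  rw [Complex.cpow_def_of_ne_zero (by exact_mod_cast hwpos.ne')]
  calc _ ≤ _ := norm_exp_sub_one_le_mul_exp _
    _ ≤ (R / c * (1 - w)) * Real.exp (R / c) :=
        mul_le_mul hz (Real.exp_le_exp.2 hz') (Real.exp_pos _).le
          (mul_nonneg (by positivity) (by linarith))
    _ = _ := by ring

lemma one_sub_pow_le {r : ℝ} (h0 : 0 ≤ r) (m : ℕ) : 1 - r ^ m ≤ m * (1 - r) := by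
  have := one_add_mul_le_pow (show (-2 : ℝ) ≤ r - 1 by linarith) m
  rw [add_sub_cancel] at this
  linarith

lemma norm_weight_sub_one_le {c w r R Q : ℝ} {s : ℂ} {m : ℕ} (hc : 0 < c) (hw : c ≤ w)
    (hw1 : w ≤ 1) (hs : ‖s‖ ≤ R) (hr0 : 0 ≤ r) (hr1 : r ≤ 1) (hwQ : 1 - w ≤ Q)
    (hrQ : 1 - r ≤ Q / c) :
    ‖(w : ℂ) ^ (-s) * (r : ℂ) ^ m - 1‖ ≤
      (R / c * Real.exp (R / c) + 1 / c) * ((m : ℝ) + 1) * Q := by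
  have hR : 0 ≤ R := (norm_nonneg s).trans hs
  have hQ : 0 ≤ Q := by linarith
  have h1 : (w : ℂ) ^ (-s) * (r : ℂ) ^ m - 1 =
      ((w : ℂ) ^ (-s) - 1) * (r : ℂ) ^ m + ((r ^ m - 1 : ℝ) : ℂ) := by push_cast; ring
  have h2 := norm_cpow_neg_sub_one_le hc hw hw1 hs
  have hrm : r ^ m ≤ 1 := pow_le_one₀ hr0 hr1
  have h3 : ‖((w : ℂ) ^ (-s) - 1) * (r : ℂ) ^ m‖ ≤ R / c * Real.exp (R / c) * Q := by
    rw [norm_mul, norm_pow, Complex.norm_real, Real.norm_of_nonneg hr0]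
    calc _ ≤ ‖(w : ℂ) ^ (-s) - 1‖ := mul_le_of_le_one_right (norm_nonneg _) hrm
      _ ≤ _ := h2.trans (mul_le_mul_of_nonneg_left hwQ (by positivity))
  have h4 : ‖((r ^ m - 1 : ℝ) : ℂ)‖ ≤ m * (Q / c) := by
    rw [Complex.norm_real, Real.norm_eq_abs, abs_sub_comm, abs_of_nonneg (by linarith)]
    exact (one_sub_pow_le hr0 m).trans (mul_le_mul_of_nonneg_left hrQ (by positivity))
  rw [h1]
  refine (norm_add_le _ _).trans ((add_le_add h3 h4).trans ?_)
  have e : (R / c * Real.exp (R / c) + 1 / c) * ((m : ℝ) + 1) * Q =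
      (R / c * Real.exp (R / c) * Q + m * (Q / c)) +
        (R / c * Real.exp (R / c) * Q * m + Q / c) := by ring
  rw [e]
  have : 0 ≤ R / c * Real.exp (R / c) * Q * m + Q / c := by positivity
  linarith

/-- The constant in the uniform estimate of the weights. -/
noncomputable def weightConst (q R : ℝ) : ℝ :=
  R / (1 - q) * Real.exp (R / (1 - q)) + 1 / (1 - q)

lemma norm_weightL_sub_one_le {q R : ℝ} (hq0 : 0 < q) (hq1 : q < 1) {s : ℂ} (hs : ‖s‖ ≤ R)
    (p : ℕ × ℕ × ℕ) :
    ‖weightL q s p - 1‖ ≤ weightConst q R * ((p.1 : ℝ) + 3) * q ^ (p.2.1 + 1) := by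
  have := norm_weight_sub_one_le (m := p.1 + 2) (Q := q ^ (p.2.1 + 1)) (sub_pos.2 hq1)
    (qgap_lower hq0 hq1 p.2.1) (qgap_le_one hq0 _) hs (qrat_nonneg hq0 hq1 p.2.1 p.2.2)
    (qrat_le_one hq0 hq1 _ _) (by simp [qgap]) (one_sub_qrat_le hq0 hq1 _ _)
  refine this.trans (le_of_eq ?_)
  simp only [weightConst]; push_cast; ring

lemma norm_weightR_sub_one_le {q R : ℝ} (hq0 : 0 < q) (hq1 : q < 1) {s : ℂ} (hs : ‖s‖ ≤ R)
    (p : ℕ × ℕ × ℕ) :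
    ‖weightR q s p - 1‖ ≤ weightConst q R * ((p.1 : ℝ) + 3) * q ^ (p.2.1 + 1) := by
  have hR : 0 ≤ R := (norm_nonneg s).trans hs
  have hq : 0 < 1 - q := sub_pos.2 hq1
  have := norm_weight_sub_one_le (m := p.1) (Q := q ^ (p.2.1 + 1)) hq
    (qgap_lower hq0 hq1 (p.2.1 + p.2.2 + 1)) (qgap_le_one hq0 _) hs
    (qrat_nonneg hq0 hq1 p.2.1 p.2.2)
    (qrat_le_one hq0 hq1 _ _)
    (by have := qgap_mono hq0 hq1 p.2.1 p.2.2; simp only [qgap] at this ⊢; linarith)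
    (one_sub_qrat_le hq0 hq1 _ _)
  refine this.trans ?_
  simp only [weightConst]
  gcongr
  norm_num

lemma norm_wterm_le {q ρ R : ℝ} (hq0 : 0 < q) (hq1 : q < 1) (hR : 0 ≤ R) {x t : ℂ}
    (hx : ‖x‖ * q ≤ ρ) (ht : ‖t‖ ≤ ρ) {w : ℕ × ℕ × ℕ → ℂ} {p : ℕ × ℕ × ℕ}
    (hw : ‖w p‖ ≤ weightConst q R * ((p.1 : ℝ) + 3) * q ^ (p.2.1 + 1)) :
    ‖wterm q x t w p‖ ≤ domFam q ρ (weightConst q R) p := by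
  obtain ⟨n, i, j⟩ := p
  simp only at hw
  have hq : 0 < 1 - q := sub_pos.2 hq1
  have hρ : 0 ≤ ρ := (norm_nonneg t).trans ht
  have hC : 0 ≤ weightConst q R := by unfold weightConst; positivity
  have hg : ‖geo q t (n, j)‖ ≤ ρ ^ (j + 1) * q ^ n := by
    simp only [geo, norm_pow, norm_mul, mul_pow, Complex.norm_real, Real.norm_of_nonneg hq0.le]
    refine mul_le_mul (pow_le_pow_left₀ (norm_nonneg _) ht _) ?_ (by positivity) (by positivity)
    exact pow_le_of_le_one (by positivity) (pow_le_one₀ hq0.le hq1.le) (Nat.succ_ne_zero j)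
  simp only [wterm, domFam, norm_mul, norm_pow]
  calc ‖x‖ ^ (i + 1) * ‖geo q t (n, j)‖ * ‖w (n, i, j)‖
      ≤ ‖x‖ ^ (i + 1) * (ρ ^ (j + 1) * q ^ n) *
        (weightConst q R * ((n : ℝ) + 3) * q ^ (i + 1)) := by gcongr
    _ = (‖x‖ * q) ^ (i + 1) * (weightConst q R * ((n : ℝ) + 3) * q ^ n * ρ ^ (j + 1)) := by ring
    _ ≤ ρ ^ (i + 1) * (weightConst q R * ((n : ℝ) + 3) * q ^ n * ρ ^ (j + 1)) := by gcongr
    _ = _ := by ring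

lemma summable_pow_succ {ρ : ℝ} (h0 : 0 ≤ ρ) (h1 : ρ < 1) : Summable fun i : ℕ => ρ ^ (i + 1) :=
  (summable_nat_add_iff 1).2 (summable_geometric_of_lt_one h0 h1)

lemma summable_domFam {q ρ : ℝ} (hq0 : 0 < q) (hq1 : q < 1) (h0 : 0 ≤ ρ) (h1 : ρ < 1) (C : ℝ) :
    Summable (domFam q ρ C) := by
  have hn : Summable fun n : ℕ => ((n : ℝ) + 3) * q ^ n := by
    have hq : ‖q‖ < 1 := by rwa [Real.norm_of_nonneg hq0.le]
    have a := summable_pow_mul_geometric_of_norm_lt_one 1 hq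
    have b := (summable_geometric_of_lt_one hq0.le hq1).mul_left 3
    refine (a.add b).congr fun n => ?_
    ring
  have hi := summable_pow_succ h0 h1
  have hij := hi.mul_of_nonneg hi (fun _ => by positivity) (fun _ => by positivity)
  exact (hn.mul_of_nonneg hij (fun _ => by positivity) (fun _ => by positivity)).mul_left C

lemma norm_geo_le {q ρ : ℝ} (hq0 : 0 < q) (hq1 : q < 1) {t : ℂ} (ht : ‖t‖ ≤ ρ) (p : ℕ × ℕ) :
    ‖geo q t p‖ ≤ q ^ p.1 * ρ ^ (p.2 + 1) := by
  have hρ : 0 ≤ ρ := (norm_nonneg t).trans ht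
  simp only [geo, norm_pow, norm_mul, mul_pow, Complex.norm_real, Real.norm_of_nonneg hq0.le]
  rw [mul_comm]
  refine mul_le_mul ?_ (pow_le_pow_left₀ (norm_nonneg _) ht _) (by positivity) (by positivity)
  exact pow_le_of_le_one (by positivity) (pow_le_one₀ hq0.le hq1.le) (Nat.succ_ne_zero _)

lemma summable_geo_bound {q ρ : ℝ} (hq0 : 0 < q) (hq1 : q < 1) (h0 : 0 ≤ ρ) (h1 : ρ < 1) :
    Summable fun p : ℕ × ℕ => q ^ p.1 * ρ ^ (p.2 + 1) :=
  (summable_geometric_of_lt_one hq0.le hq1).mul_of_nonneg (summable_pow_succ h0 h1)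
    (fun _ => by positivity) (fun _ => by positivity)

lemma norm_qx {q : ℝ} (hq0 : 0 < q) (s : ℂ) : ‖qx q s‖ = q ^ (s.re - 2) := by
  rw [qx, Complex.norm_cpow_eq_rpow_re_of_pos hq0]; simp

lemma norm_qx_mul_lt_one {q : ℝ} (hq0 : 0 < q) (hq1 : q < 1) {s : ℂ} (hs : 1 < s.re) :
    ‖qx q s‖ * q < 1 := by
  rw [norm_qx hq0]
  nth_rewrite 2 [← Real.rpow_one q]
  rw [← Real.rpow_add hq0]
  exact Real.rpow_lt_one hq0.le hq1 (by linarith)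

lemma norm_qx_lt_one {q : ℝ} (hq0 : 0 < q) (hq1 : q < 1) {s : ℂ} (hs : 2 < s.re) :
    ‖qx q s‖ < 1 := by
  rw [norm_qx hq0]
  exact Real.rpow_lt_one hq0.le hq1 (by linarith)

lemma differentiable_qx {q : ℝ} (hq0 : 0 < q) : Differentiable ℂ (qx q) := by
  have : (q : ℂ) ≠ 0 := by exact_mod_cast hq0.ne'
  exact (differentiable_id.sub_const 2).const_cpow (Or.inl this)

lemma exists_radius {q : ℝ} (hq0 : 0 < q) (hq1 : q < 1) {s : ℂ} (hs : 1 < s.re) :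
    ∃ ρ, q ≤ ρ ∧ ρ < 1 ∧ ‖qx q s‖ * q < ρ := by
  obtain ⟨ρ, h1, h2⟩ := exists_between (max_lt hq1 (norm_qx_mul_lt_one hq0 hq1 hs))
  exact ⟨ρ, (le_max_left _ _).trans h1.le, h2, (le_max_right _ _).trans_lt h1⟩

/-- Domination by a summable family, locally uniformly on the half-plane `Re s > 1`. -/
def LocallyDominated {ι : Type*} (q : ℝ) (F : ι → ℂ → ℂ) : Prop :=
  ∀ ρ R : ℝ, q ≤ ρ → ρ < 1 → 0 ≤ R → ∃ b : ι → ℝ, Summable b ∧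
    ∀ i s, ‖qx q s‖ * q ≤ ρ → ‖s‖ ≤ R → ‖F i s‖ ≤ b i

lemma LocallyDominated.sub {ι : Type*} {q : ℝ} {F G : ι → ℂ → ℂ}
    (hF : LocallyDominated q F) (hG : LocallyDominated q G) :
    LocallyDominated q fun i s => F i s - G i s := by
  intro ρ R h1 h2 h3
  obtain ⟨b, hb, hb'⟩ := hF ρ R h1 h2 h3
  obtain ⟨c, hc, hc'⟩ := hG ρ R h1 h2 h3
  exact ⟨fun i => b i + c i, hb.add hc, fun i s hx hs =>
    (norm_sub_le _ _).trans (add_le_add (hb' i s hx hs) (hc' i s hx hs))⟩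

lemma LocallyDominated.summable {ι : Type*} {q : ℝ} (hq0 : 0 < q) (hq1 : q < 1)
    {F : ι → ℂ → ℂ} (hF : LocallyDominated q F) {s : ℂ} (hs : 1 < s.re) :
    Summable fun i => F i s := by
  obtain ⟨ρ, h1, h2, h3⟩ := exists_radius hq0 hq1 hs
  obtain ⟨b, hb, hb'⟩ := hF ρ ‖s‖ h1 h2 (norm_nonneg _)
  exact Summable.of_norm_bounded hb fun i => hb' i s h3.le le_rfl

lemma LocallyDominated.differentiableOn_tsum {ι : Type*} {q : ℝ} (hq0 : 0 < q) (hq1 : q < 1)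
    {F : ι → ℂ → ℂ} (hF : LocallyDominated q F) (hd : ∀ i, Differentiable ℂ (F i)) :
    DifferentiableOn ℂ (fun s => ∑' i, F i s) {s | 1 < s.re} := by
  intro s hs
  obtain ⟨ρ, h1, h2, h3⟩ := exists_radius hq0 hq1 hs
  obtain ⟨b, hb, hb'⟩ := hF ρ (‖s‖ + 1) h1 h2 (by positivity)
  have hU : IsOpen {z : ℂ | ‖qx q z‖ * q < ρ ∧ ‖z‖ < ‖s‖ + 1} :=
    (isOpen_lt ((differentiable_qx hq0).continuous.norm.mul continuous_const)
      continuous_const).inter (isOpen_lt continuous_norm continuous_const)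
  have := Complex.differentiableOn_tsum_of_summable_norm hb
    (fun i => (hd i).differentiableOn) hU (fun i z hz => hb' i z hz.1.le hz.2.le)
  exact (this.differentiableAt (hU.mem_nhds ⟨h3, by linarith⟩)).differentiableWithinAt

/-- The regularised general term of the analytic continuation of `ζ_q(s-n-2, n+2)`. -/
noncomputable def regL (q : ℝ) (p : ℕ × ℕ × ℕ) (s : ℂ) : ℂ :=
  wterm q (qx q s) q (fun p => weightL q s p - 1) p

/-- The regularised general term of the analytic continuation of `ζ_q(-n, s+n)`. -/
noncomputable def regR (q : ℝ) (p : ℕ × ℕ × ℕ) (s : ℂ) : ℂ :=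
  wterm q (qx q s) (q * qx q s) (fun p => weightR q s p - 1) p

lemma norm_mul_qx_le {q ρ : ℝ} (hq0 : 0 < q) {s : ℂ} (hx : ‖qx q s‖ * q ≤ ρ) :
    ‖(q : ℂ) * qx q s‖ ≤ ρ := by
  rwa [norm_mul, Complex.norm_real, Real.norm_of_nonneg hq0.le, mul_comm]

lemma locallyDominated_regL {q : ℝ} (hq0 : 0 < q) (hq1 : q < 1) :
    LocallyDominated q (regL q) := fun _ R h1 h2 h3 =>
  ⟨_, summable_domFam hq0 hq1 (hq0.le.trans h1) h2 (weightConst q R), fun p _ hx hs =>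
    norm_wterm_le hq0 hq1 h3 hx
      (by rwa [Complex.norm_real, Real.norm_of_nonneg hq0.le])
      (norm_weightL_sub_one_le hq0 hq1 hs p)⟩

lemma locallyDominated_regR {q : ℝ} (hq0 : 0 < q) (hq1 : q < 1) :
    LocallyDominated q (regR q) := fun _ R h1 h2 h3 =>
  ⟨_, summable_domFam hq0 hq1 (hq0.le.trans h1) h2 (weightConst q R), fun p _ hx hs =>
    norm_wterm_le hq0 hq1 h3 hx (norm_mul_qx_le hq0 hx)
      (norm_weightR_sub_one_le hq0 hq1 hs p)⟩

lemma locallyDominated_geoL {q : ℝ} (hq0 : 0 < q) (hq1 : q < 1) :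
    LocallyDominated q fun p _ => geo q q p := fun _ _ h1 h2 _ =>
  ⟨_, summable_geo_bound hq0 hq1 (hq0.le.trans h1) h2, fun p _ _ _ =>
    norm_geo_le hq0 hq1 (by rwa [Complex.norm_real, Real.norm_of_nonneg hq0.le]) p⟩

lemma locallyDominated_geoR {q : ℝ} (hq0 : 0 < q) (hq1 : q < 1) :
    LocallyDominated q fun p s => geo q (q * qx q s) p := fun _ _ h1 h2 _ =>
  ⟨_, summable_geo_bound hq0 hq1 (hq0.le.trans h1) h2, fun p _ hx _ =>
    norm_geo_le hq0 hq1 (norm_mul_qx_le hq0 hx) p⟩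

/-- The general term of `ζ_q(s)`, up to the factor `(1-q)^s`. -/
noncomputable def zetaFam (q : ℝ) (N : ℕ) (s : ℂ) : ℂ :=
  (q * qx q s) ^ (N + 1) * (qgap q N : ℂ) ^ (-s)

lemma locallyDominated_zetaFam {q : ℝ} (hq0 : 0 < q) (hq1 : q < 1) :
    LocallyDominated q (zetaFam q) := by
  intro ρ R h1 h2 h3
  have hq : 0 < 1 - q := sub_pos.2 hq1
  refine ⟨_, (summable_pow_succ (hq0.le.trans h1) h2).mul_right
    (R / (1 - q) * Real.exp (R / (1 - q)) + 1), fun N s hx hs => ?_⟩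
  have hw := norm_cpow_neg_sub_one_le hq (qgap_lower hq0 hq1 N) (qgap_le_one hq0 N) hs
  have hw' : ‖(qgap q N : ℂ) ^ (-s)‖ ≤ R / (1 - q) * Real.exp (R / (1 - q)) + 1 := by
    have h := norm_add_le ((qgap q N : ℂ) ^ (-s) - 1) 1
    rw [sub_add_cancel, norm_one] at h
    have := mul_le_of_le_one_right (a := R / (1 - q) * Real.exp (R / (1 - q)))
      (b := 1 - qgap q N) (by positivity) (by linarith [qgap_pos hq0 hq1 N])
    linarith
  rw [zetaFam, norm_mul, norm_pow]
  exact mul_le_mul (pow_le_pow_left₀ (norm_nonneg _) (norm_mul_qx_le hq0 hx) _) hw'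
    (norm_nonneg _) (pow_nonneg (hq0.le.trans h1) _)

lemma differentiable_qgap_cpow {q : ℝ} (hq0 : 0 < q) (hq1 : q < 1) (i : ℕ) :
    Differentiable ℂ fun s : ℂ => (qgap q i : ℂ) ^ (-s) :=
  differentiable_id.neg.const_cpow (Or.inl (by exact_mod_cast (qgap_pos hq0 hq1 i).ne'))

lemma differentiable_regL {q : ℝ} (hq0 : 0 < q) (hq1 : q < 1) (p : ℕ × ℕ × ℕ) :
    Differentiable ℂ (regL q p) := by
  have h1 := differentiable_qx hq0
  have h2 := differentiable_qgap_cpow hq0 hq1 p.2.1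
  unfold regL wterm weightL geo
  fun_prop

lemma differentiable_regR {q : ℝ} (hq0 : 0 < q) (hq1 : q < 1) (p : ℕ × ℕ × ℕ) :
    Differentiable ℂ (regR q p) := by
  have h1 := differentiable_qx hq0
  have h2 := differentiable_qgap_cpow hq0 hq1 (p.2.1 + p.2.2 + 1)
  unfold regR wterm weightR geo
  fun_prop

lemma differentiable_geoR {q : ℝ} (hq0 : 0 < q) (p : ℕ × ℕ) :
    Differentiable ℂ fun s => geo q (q * qx q s) p := by
  have h1 := differentiable_qx hq0
  unfold geo
  fun_prop

lemma differentiable_zetaFam {q : ℝ} (hq0 : 0 < q) (hq1 : q < 1) (N : ℕ) :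
    Differentiable ℂ (zetaFam q N) := by
  have h1 := differentiable_qx hq0
  have h2 := differentiable_qgap_cpow hq0 hq1 N
  unfold zetaFam
  fun_prop

/-- Moves the middle index of a triple to the front. -/
def frontEquiv : ℕ × ℕ × ℕ ≃ ℕ × ℕ × ℕ where
  toFun p := (p.2.1, p.1, p.2.2)
  invFun p := (p.2.1, p.1, p.2.2)
  left_inv _ := rfl
  right_inv _ := rfl

lemma HasSum.of_eq_of_eq {ι : Type*} {f g : ι → ℂ} {a b : ℂ} (h : HasSum f a)
    (hf : ∀ i, g i = f i) (ha : b = a) : HasSum g b := by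
  rwa [funext hf, ha]

lemma hasSum_pow_succ {x : ℂ} (hx : ‖x‖ < 1) :
    HasSum (fun i : ℕ => x ^ (i + 1)) (x / (1 - x)) := by
  simpa [pow_succ', div_eq_mul_inv] using (hasSum_geometric_of_norm_lt_one hx).mul_left x

lemma hasSum_wterm_one {q : ℝ} {x t : ℂ} (hx : ‖x‖ < 1) (ht : Summable (geo q t)) :
    HasSum (wterm q x t fun _ => 1) (x / (1 - x) * ∑' p, geo q t p) := by
  have h1 := hasSum_pow_succ hx
  have hs : Summable fun p : ℕ × ℕ × ℕ => x ^ (p.1 + 1) * geo q t p.2 :=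
    summable_mul_of_summable_norm (f := fun i : ℕ => x ^ (i + 1)) (g := geo q t)
      h1.summable.norm ht.norm
  have h2 : HasSum (fun p : ℕ × ℕ × ℕ => x ^ (p.1 + 1) * geo q t p.2)
      (x / (1 - x) * ∑' p, geo q t p) := h1.mul ht.hasSum hs
  have h3 : HasSum (fun p => x ^ ((frontEquiv p).1 + 1) * geo q t (frontEquiv p).2)
      (x / (1 - x) * ∑' p, geo q t p) := frontEquiv.hasSum_iff.2 h2
  refine h3.of_eq_of_eq (fun p => ?_) rfl
  rw [wterm, mul_one]
  rfl

lemma wterm_eq_add (q : ℝ) (x t : ℂ) (w : ℕ × ℕ × ℕ → ℂ) (p : ℕ × ℕ × ℕ) :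
    wterm q x t w p = wterm q x t (fun p => w p - 1) p + wterm q x t (fun _ => 1) p := by
  simp only [wterm]; ring

/-- The full general term of the double series `ζ_q(s-n-2, n+2)`, up to the factor `(1-q)^s`. -/
noncomputable def fullL (q : ℝ) (s : ℂ) : ℕ × ℕ × ℕ → ℂ := wterm q (qx q s) q (weightL q s)

/-- The full general term of the double series `ζ_q(-n, s+n)`, up to the factor `(1-q)^s`. -/
noncomputable def fullR (q : ℝ) (s : ℂ) : ℕ × ℕ × ℕ → ℂ :=
  wterm q (qx q s) (q * qx q s) (weightR q s)

lemma hasSum_fullL {q : ℝ} (hq0 : 0 < q) (hq1 : q < 1) {s : ℂ} (hs : 2 < s.re) :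
    HasSum (fullL q s)
      (∑' p, regL q p s + qx q s / (1 - qx q s) * ∑' p, geo q q p) := by
  have h1 := (locallyDominated_regL hq0 hq1).summable hq0 hq1 (show 1 < s.re by linarith)
  have h2 := (locallyDominated_geoL hq0 hq1).summable hq0 hq1 (show 1 < s.re by linarith)
  exact (h1.hasSum.add (hasSum_wterm_one (norm_qx_lt_one hq0 hq1 hs) h2)).of_eq_of_eq
    (fun p => wterm_eq_add _ _ _ _ _) rfl

lemma hasSum_fullR {q : ℝ} (hq0 : 0 < q) (hq1 : q < 1) {s : ℂ} (hs : 2 < s.re) :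
    HasSum (fullR q s)
      (∑' p, regR q p s + qx q s / (1 - qx q s) * ∑' p, geo q (q * qx q s) p) := by
  have h1 := (locallyDominated_regR hq0 hq1).summable hq0 hq1 (show 1 < s.re by linarith)
  have h2 := (locallyDominated_geoR hq0 hq1).summable hq0 hq1 (show 1 < s.re by linarith)
  exact (h1.hasSum.add (hasSum_wterm_one (norm_qx_lt_one hq0 hq1 hs) h2)).of_eq_of_eq
    (fun p => wterm_eq_add _ _ _ _ _) rfl

/-- The Lambert term `q^(j+1) / (1 - q^(j+1))`. -/
noncomputable def lambert (q : ℝ) (j : ℕ) : ℂ := (q : ℂ) ^ (j + 1) / (qgap q j : ℂ)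

/-- The coefficient of the partial Lambert sums. -/
noncomputable def coefA (q : ℝ) (s : ℂ) (i : ℕ) : ℂ :=
  qx q s ^ (i + 1) * (qgap q i : ℂ) ^ (-s) * (qgap q i : ℂ)

lemma qgap_cast_ne_zero {q : ℝ} (hq0 : 0 < q) (hq1 : q < 1) (i : ℕ) : (qgap q i : ℂ) ≠ 0 := by
  exact_mod_cast (qgap_pos hq0 hq1 i).ne'

lemma summable_lambert {q : ℝ} (hq0 : 0 < q) (hq1 : q < 1) : Summable (lambert q) := by
  refine Summable.of_norm_bounded ((summable_pow_succ hq0.le hq1).mul_right (1 / (1 - q)))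
    fun j => ?_
  have hq : 0 < 1 - q := sub_pos.2 hq1
  rw [lambert, norm_div, norm_pow, Complex.norm_real, Complex.norm_real,
    Real.norm_of_nonneg hq0.le, Real.norm_of_nonneg (qgap_pos hq0 hq1 j).le, div_eq_mul_one_div]
  gcongr
  exact qgap_lower hq0 hq1 j

/-- The geometric series in `n` with ratio `q^(j+1) r`. -/
lemma hasSum_geo_ratio {q : ℝ} (hq0 : 0 < q) (hq1 : q < 1) (i j : ℕ) :
    HasSum (fun n : ℕ => ((q : ℂ) ^ n) ^ (j + 1) * (qrat q i j : ℂ) ^ n)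
      (qgap q (i + j + 1) / qgap q j : ℂ) := by
  have hn : ‖(q : ℂ) ^ (j + 1) * (qrat q i j : ℂ)‖ < 1 := by
    rw [norm_mul, norm_pow, Complex.norm_real, Complex.norm_real,
      Real.norm_of_nonneg hq0.le, Real.norm_of_nonneg (qrat_nonneg hq0 hq1 _ _)]
    exact (mul_le_of_le_one_right (by positivity) (qrat_le_one hq0 hq1 _ _)).trans_lt
      (pow_lt_one₀ hq0.le hq1 (by omega))
  refine (hasSum_geometric_of_norm_lt_one hn).of_eq_of_eq (fun n => ?_) ?_
  · rw [mul_pow, ← pow_mul, ← pow_mul, mul_comm n]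
  · have h1 := qgap_cast_ne_zero hq0 hq1 j
    have h2 := qgap_cast_ne_zero hq0 hq1 (i + j + 1)
    have h3 : 1 - (q : ℂ) ^ (j + 1) * (qrat q i j : ℂ) = qgap q j / qgap q (i + j + 1) := by
      rw [qrat]
      push_cast
      field_simp
      simp only [qgap]
      push_cast
      ring
    rw [h3, inv_div]

lemma hasSum_fullL_fiber {q : ℝ} (hq0 : 0 < q) (hq1 : q < 1) (s : ℂ) (i j : ℕ) :
    HasSum (fun n : ℕ => fullL q s (n, i, j))
      (coefA q s i * (lambert q j - lambert q (j + (i + 1)))) := by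
  have h1 := qgap_cast_ne_zero hq0 hq1 j
  have h2 := qgap_cast_ne_zero hq0 hq1 (i + j + 1)
  refine ((hasSum_geo_ratio hq0 hq1 i j).mul_left (qx q s ^ (i + 1) * (q : ℂ) ^ (j + 1) *
    (qgap q i : ℂ) ^ (-s) * (qrat q i j : ℂ) ^ 2)).of_eq_of_eq (fun n => ?_) ?_
  · simp only [fullL, wterm, geo, weightL, mul_pow, pow_add]
    ring
  · rw [show j + (i + 1) = i + j + 1 by ring]
    simp only [coefA, lambert, qrat]
    push_cast
    field_simp
    simp only [qgap]
    push_cast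
    ring

lemma hasSum_fullR_fiber {q : ℝ} (hq0 : 0 < q) (hq1 : q < 1) (s : ℂ) (i j : ℕ) :
    HasSum (fun n : ℕ => fullR q s (n, i, j)) (coefA q s (i + j + 1) * lambert q j) := by
  have h1 := qgap_cast_ne_zero hq0 hq1 j
  refine ((hasSum_geo_ratio hq0 hq1 i j).mul_left (qx q s ^ (i + 1) * (q * qx q s) ^ (j + 1) *
    (qgap q (i + j + 1) : ℂ) ^ (-s))).of_eq_of_eq (fun n => ?_) ?_
  · simp only [fullR, wterm, geo, weightR, mul_pow]
    ring
  · simp only [coefA, lambert]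
    ring

/-- The partial Lambert sums. -/
noncomputable def lambertSum (q : ℝ) (N : ℕ) : ℂ := ∑ j ∈ Finset.range N, lambert q j

lemma hasSum_fullL_regroup {q : ℝ} (hq0 : 0 < q) (hq1 : q < 1) {s T : ℂ}
    (h : HasSum (fullL q s) T) :
    HasSum (fun N => coefA q s N * lambertSum q (N + 1)) T := by
  have h1 := ((Equiv.prodComm (ℕ × ℕ) ℕ).hasSum_iff).2 h
  have h2 := h1.prod_fiberwise (fun ij => hasSum_fullL_fiber hq0 hq1 s ij.1 ij.2)
  refine h2.prod_fiberwise fun i => ?_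
  have hl := (summable_lambert hq0 hq1).hasSum
  refine ((hl.sub ((hasSum_nat_add_iff' (i + 1)).2 hl)).mul_left (coefA q s i)).of_eq_of_eq
    (fun j => rfl) ?_
  rw [lambertSum, sub_sub_cancel]

lemma hasSum_fullR_regroup {q : ℝ} (hq0 : 0 < q) (hq1 : q < 1) {s T : ℂ}
    (h : HasSum (fullR q s) T) :
    HasSum (fun N => coefA q s N * lambertSum q N) T := by
  have h1 := ((Equiv.prodComm (ℕ × ℕ) ℕ).hasSum_iff).2 h
  have h2 := h1.prod_fiberwise (fun ij => hasSum_fullR_fiber hq0 hq1 s ij.1 ij.2)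
  have h3 := (Finset.HasAntidiagonal.sigmaAntidiagonalEquivProd.hasSum_iff).2 h2
  have h4 : HasSum (fun N => coefA q s (N + 1) * lambertSum q (N + 1)) T := by
    refine h3.sigma fun N => ?_
    refine (hasSum_fintype _).of_eq_of_eq (fun _ => rfl) ?_
    simp only [Function.comp_def, Finset.HasAntidiagonal.sigmaAntidiagonalEquivProd_apply]
    rw [Finset.sum_coe_sort (Finset.HasAntidiagonal.antidiagonal N)
      (fun p => coefA q s (p.1 + p.2 + 1) * lambert q p.2), ← Finset.Nat.sum_antidiagonal_swap,
      Finset.Nat.sum_antidiagonal_eq_sum_range_succ_mk, lambertSum, Finset.mul_sum]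
    refine Finset.sum_congr rfl fun k hk => ?_
    have hk' : k ≤ N := by simpa [Nat.lt_succ_iff] using hk
    simp [Nat.sub_add_cancel hk']
  have h5 := (hasSum_nat_add_iff' (f := fun N => coefA q s N * lambertSum q N) (g := T) 1).1
  refine h5 ?_
  simpa [lambertSum] using h4

/-- The sum formula in the domain of absolute convergence, in terms of the regularised series. -/
lemma regularised_sum_formula {q : ℝ} (hq0 : 0 < q) (hq1 : q < 1) {s : ℂ} (hs : 2 < s.re) :
    ∑' p, (regL q p s - regR q p s) + qx q s / (1 - qx q s) *
      ∑' p, (geo q q p - geo q (q * qx q s) p) = ∑' N, zetaFam q N s := by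
  have hs1 : 1 < s.re := by linarith
  have hL := hasSum_fullL_regroup hq0 hq1 (hasSum_fullL hq0 hq1 hs)
  have hR := hasSum_fullR_regroup hq0 hq1 (hasSum_fullR hq0 hq1 hs)
  have h := (hL.sub hR).of_eq_of_eq (g := fun N => zetaFam q N s) (fun N => by
    have := qgap_cast_ne_zero hq0 hq1 N
    simp only [lambertSum, Finset.sum_range_succ, coefA, lambert, zetaFam]
    field_simp
    ring) rfl
  rw [h.tsum_eq,
    ((locallyDominated_regL hq0 hq1).summable hq0 hq1 hs1).tsum_sub
      ((locallyDominated_regR hq0 hq1).summable hq0 hq1 hs1),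
    ((locallyDominated_geoL hq0 hq1).summable hq0 hq1 hs1).tsum_sub
      ((locallyDominated_geoR hq0 hq1).summable hq0 hq1 hs1)]
  ring

/-- The index set of the double zeta series, parametrised by `n₁ - 1` and `n₂ - n₁ - 1`. -/
def i2Equiv : ℕ × ℕ ≃ I2 where
  toFun p := ⟨(p.1 + 1, p.1 + p.2 + 2), by omega, by simp only; omega⟩
  invFun p := (p.1.1 - 1, p.1.2 - p.1.1 - 1)
  left_inv p := by ext <;> simp only <;> omega
  right_inv p := by
    obtain ⟨⟨a, b⟩, h1, h2⟩ := p
    simp only at h1 h2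
    apply Subtype.ext
    ext <;> simp only <;> omega

lemma qnum_succ (q : ℝ) (i : ℕ) : qnum q (i + 1) = qgap q i / (1 - q) := rfl

lemma qnum_succ_cpow {q : ℝ} (hq0 : 0 < q) (hq1 : q < 1) (i : ℕ) (s : ℂ) :
    (qnum q (i + 1) : ℂ) ^ s = (qgap q i : ℂ) ^ s / ((1 - q : ℝ) : ℂ) ^ s := by
  have h : ((1 - q : ℝ) : ℂ) ≠ 0 := by exact_mod_cast (sub_pos.2 hq1).ne'
  have h' : ((1 - q : ℝ) : ℂ) ^ s ≠ 0 :=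
    fun h0 => h ((Complex.cpow_eq_zero_iff _ _).1 h0).1
  rw [eq_div_iff h', ← Complex.mul_cpow_ofReal_nonneg _ (sub_pos.2 hq1).le, qnum_succ,
    ← Complex.ofReal_mul, div_mul_cancel₀ _ (sub_pos.2 hq1).ne']
  exact div_nonneg (qgap_pos hq0 hq1 i).le (sub_pos.2 hq1).le

lemma zterm2_eq {q : ℝ} (hq0 : 0 < q) (hq1 : q < 1) (s₁ s₂ : ℂ) (i j : ℕ) :
    zterm2 q s₁ s₂ (i + 1, i + j + 2) =
      ((1 - q : ℝ) : ℂ) ^ (s₁ + s₂) * (qx q (s₁ + s₂) ^ (i + 1) *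
        ((q : ℂ) ^ (s₂ - 1)) ^ (j + 1) *
        ((qgap q i : ℂ) ^ (-s₁) * (qgap q (i + j + 1) : ℂ) ^ (-s₂))) := by
  have h : ((1 - q : ℝ) : ℂ) ≠ 0 := by exact_mod_cast (sub_pos.2 hq1).ne'
  have hq : (q : ℂ) ≠ 0 := by exact_mod_cast hq0.ne'
  have e1 : (q : ℂ) ^ ((s₁ - 1) * ((i + 1 : ℕ) : ℂ)) *
      (q : ℂ) ^ ((s₂ - 1) * ((i + j + 2 : ℕ) : ℂ)) =
      qx q (s₁ + s₂) ^ (i + 1) * ((q : ℂ) ^ (s₂ - 1)) ^ (j + 1) := by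
    rw [qx, ← Complex.cpow_nat_mul, ← Complex.cpow_nat_mul, ← Complex.cpow_add _ _ hq,
      ← Complex.cpow_add _ _ hq]
    congr 1
    push_cast
    ring
  simp only [zterm2]
  rw [e1, show i + j + 2 = i + j + 1 + 1 by ring, qnum_succ_cpow hq0 hq1,
    qnum_succ_cpow hq0 hq1, Complex.cpow_add _ _ h, Complex.cpow_neg, Complex.cpow_neg]
  simp only [div_eq_mul_inv, mul_inv, inv_inv]
  ring

lemma zterm1_eq_s2 {q : ℝ} (hq0 : 0 < q) (hq1 : q < 1) (s : ℂ) (N : ℕ) :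
    zterm1 q s (N + 1) = ((1 - q : ℝ) : ℂ) ^ s * zetaFam q N s := by
  have hq : (q : ℂ) ≠ 0 := by exact_mod_cast hq0.ne'
  have e1 : (q : ℂ) ^ ((s - 1) * ((N + 1 : ℕ) : ℂ)) = (q * qx q s) ^ (N + 1) := by
    rw [mul_comm, Complex.cpow_nat_mul, qx]
    congr 1
    nth_rewrite 2 [← Complex.cpow_one (q : ℂ)]
    rw [← Complex.cpow_add _ _ hq]
    congr 1
    ring
  rw [zterm1, e1, qnum_succ_cpow hq0 hq1, zetaFam, Complex.cpow_neg]
  simp only [div_eq_mul_inv, mul_inv, inv_inv]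
  ring

lemma tsum_zterm1 {q : ℝ} (hq0 : 0 < q) (hq1 : q < 1) (s : ℂ) :
    ∑' n : {n : ℕ // 0 < n}, zterm1 q s n.1 =
      ((1 - q : ℝ) : ℂ) ^ s * ∑' N, zetaFam q N s := by
  rw [← tsum_mul_left]
  exact (Equiv.pnatEquivNat.symm.tsum_eq fun n : ℕ+ => zterm1 q s n).symm.trans
    (tsum_congr fun N => zterm1_eq_s2 hq0 hq1 s N)

lemma zterm2_left_eq_s2 {q : ℝ} (hq0 : 0 < q) (hq1 : q < 1) (s : ℂ) (n i j : ℕ) :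
    zterm2 q (s - n - 2) (n + 2) (i + 1, i + j + 2) =
      ((1 - q : ℝ) : ℂ) ^ s * fullL q s (n, i, j) := by
  have h1 := qgap_cast_ne_zero hq0 hq1 i
  have h2 := qgap_cast_ne_zero hq0 hq1 (i + j + 1)
  have e1 : (q : ℂ) ^ ((n : ℂ) + 2 - 1) = q * (q : ℂ) ^ n := by
    rw [show (n : ℂ) + 2 - 1 = ((n + 1 : ℕ) : ℂ) by push_cast; ring, Complex.cpow_natCast]
    ring
  have e2 : (qgap q i : ℂ) ^ (-(s - n - 2)) =
      (qgap q i : ℂ) ^ (-s) * (qgap q i : ℂ) ^ (n + 2) := by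
    rw [show -(s - n - 2) = -s + ((n + 2 : ℕ) : ℂ) by push_cast; ring,
      Complex.cpow_add _ _ h1, Complex.cpow_natCast]
  have e3 : (qgap q (i + j + 1) : ℂ) ^ (-((n : ℂ) + 2)) =
      ((qgap q (i + j + 1) : ℂ) ^ (n + 2))⁻¹ := by
    rw [show (n : ℂ) + 2 = ((n + 2 : ℕ) : ℂ) by push_cast; ring, Complex.cpow_neg,
      Complex.cpow_natCast]
  rw [zterm2_eq hq0 hq1, show s - n - 2 + ((n : ℂ) + 2) = s by ring, e1, e2, e3]
  simp only [fullL, wterm, geo, weightL, qrat]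
  push_cast
  rw [div_pow, div_eq_mul_inv]
  ring

lemma zterm2_right_eq_s2 {q : ℝ} (hq0 : 0 < q) (hq1 : q < 1) (s : ℂ) (n i j : ℕ) :
    zterm2 q (-n) (s + n) (i + 1, i + j + 2) =
      ((1 - q : ℝ) : ℂ) ^ s * fullR q s (n, i, j) := by
  have hq : (q : ℂ) ≠ 0 := by exact_mod_cast hq0.ne'
  have h2 := qgap_cast_ne_zero hq0 hq1 (i + j + 1)
  have e1 : (q : ℂ) ^ (s + n - 1) = q * qx q s * (q : ℂ) ^ n := by
    rw [show s + n - 1 = 1 + (s - 2) + n by ring, Complex.cpow_add _ _ hq,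
      Complex.cpow_add _ _ hq, Complex.cpow_natCast, Complex.cpow_one, qx]
  have e3 : (qgap q (i + j + 1) : ℂ) ^ (-(s + n)) =
      (qgap q (i + j + 1) : ℂ) ^ (-s) * ((qgap q (i + j + 1) : ℂ) ^ n)⁻¹ := by
    rw [neg_add, Complex.cpow_add _ _ h2, Complex.cpow_neg _ (n : ℂ), Complex.cpow_natCast]
  rw [zterm2_eq hq0 hq1, show -(n : ℂ) + (s + n) = s by ring, e1, neg_neg,
    Complex.cpow_natCast, e3]
  simp only [fullR, wterm, geo, weightR, qrat]
  push_cast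
  rw [div_pow, div_eq_mul_inv]
  ring

lemma tsum_zterm2_left {q : ℝ} (hq0 : 0 < q) (hq1 : q < 1) (s : ℂ) (n : ℕ) :
    ∑' p : I2, zterm2 q (s - n - 2) (n + 2) p.1 =
      ((1 - q : ℝ) : ℂ) ^ s * ∑' p, fullL q s (n, p) := by
  rw [← i2Equiv.tsum_eq, ← tsum_mul_left]
  exact tsum_congr fun p => zterm2_left_eq_s2 hq0 hq1 s n p.1 p.2

lemma tsum_zterm2_right {q : ℝ} (hq0 : 0 < q) (hq1 : q < 1) (s : ℂ) (n : ℕ) :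
    ∑' p : I2, zterm2 q (-n) (s + n) p.1 =
      ((1 - q : ℝ) : ℂ) ^ s * ∑' p, fullR q s (n, p) := by
  rw [← i2Equiv.tsum_eq, ← tsum_mul_left]
  exact tsum_congr fun p => zterm2_right_eq_s2 hq0 hq1 s n p.1 p.2

lemma LocallyDominated.fiber {α β : Type*} {q : ℝ} {F : α × β → ℂ → ℂ}
    (hF : LocallyDominated q F) (a : α) : LocallyDominated q fun b => F (a, b) := by
  intro ρ R h1 h2 h3
  obtain ⟨b, hb, hb'⟩ := hF ρ R h1 h2 h3
  exact ⟨_, hb.prod_factor a, fun c s => hb' (a, c) s⟩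

/-- The analytically continued difference `ζ_q(s-n-2, n+2) - ζ_q(-n, s+n)`, up to the factor
`(1-q)^s`. -/
noncomputable def contDiffTerm (q : ℝ) (n : ℕ) (s : ℂ) : ℂ :=
  ∑' p, (regL q (n, p) s - regR q (n, p) s) + qx q s / (1 - qx q s) *
    ∑' j, (geo q q (n, j) - geo q (q * qx q s) (n, j))

lemma tsum_wterm_fiber {q : ℝ} {x t : ℂ} (hx : ‖x‖ < 1) {w : ℕ × ℕ × ℕ → ℂ} (n : ℕ)
    (hw : Summable fun p => wterm q x t (fun p => w p - 1) (n, p))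
    (ht : Summable fun j => geo q t (n, j)) :
    ∑' p, wterm q x t w (n, p) =
      ∑' p, wterm q x t (fun p => w p - 1) (n, p) + x / (1 - x) * ∑' j, geo q t (n, j) := by
  have h1 := hasSum_pow_succ hx
  have ht' : Summable fun j => ‖geo q t (n, j)‖ := ht.norm
  have hs : Summable fun p : ℕ × ℕ => x ^ (p.1 + 1) * geo q t (n, p.2) :=
    summable_mul_of_summable_norm (f := fun i : ℕ => x ^ (i + 1))
      (g := fun j => geo q t (n, j)) h1.summable.norm ht'
  have h2 : HasSum (fun p : ℕ × ℕ => x ^ (p.1 + 1) * geo q t (n, p.2))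
      (x / (1 - x) * ∑' j, geo q t (n, j)) := 
    HasSum.mul (f := fun i : ℕ => x ^ (i + 1)) (g := fun j => geo q t (n, j)) h1 ht.hasSum hs
  refine ((hw.hasSum.add h2).of_eq_of_eq (fun p => ?_) rfl).tsum_eq
  simp only [wterm]
  ring

lemma sub_tsum_eq_contDiffTerm {q : ℝ} (hq0 : 0 < q) (hq1 : q < 1) {s : ℂ} (hs : 2 < s.re)
    (n : ℕ) :
    ∑' p, fullL q s (n, p) - ∑' p, fullR q s (n, p) = contDiffTerm q n s := by
  have hs1 : 1 < s.re := by linarith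
  have hL := ((locallyDominated_regL hq0 hq1).fiber n).summable hq0 hq1 hs1
  have hR := ((locallyDominated_regR hq0 hq1).fiber n).summable hq0 hq1 hs1
  have hgL := ((locallyDominated_geoL hq0 hq1).fiber n).summable hq0 hq1 hs1
  have hgR := ((locallyDominated_geoR hq0 hq1).fiber n).summable hq0 hq1 hs1
  have hx := norm_qx_lt_one hq0 hq1 hs
  have e1 := tsum_wterm_fiber (w := weightL q s) hx n hL hgL
  have e2 := tsum_wterm_fiber (w := weightR q s) hx n hR hgR
  rw [contDiffTerm, hL.tsum_sub hR, hgL.tsum_sub hgR]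
  simp only [fullL, fullR]
  rw [e1, e2]
  simp only [regL, regR]
  ring

/-- The half-plane `Re s > 1` without the points where `q^(s-2) = 1`. -/
def qDomain (q : ℝ) : Set ℂ := {s | 1 < s.re ∧ qx q s ≠ 1}

lemma qx_eq_one_iff {q : ℝ} (hq0 : 0 < q) (hq1 : q < 1) (s : ℂ) :
    qx q s = 1 ↔ ∃ m : ℤ, s = 2 + 2 * (Real.pi : ℂ) * Complex.I / (Real.log q : ℂ) * m := by
  have hq : (q : ℂ) ≠ 0 := by exact_mod_cast hq0.ne'
  have hl : (Real.log q : ℂ) ≠ 0 := by exact_mod_cast (Real.log_neg hq0 hq1).ne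
  rw [qx, Complex.cpow_def_of_ne_zero hq, ← Complex.ofReal_log hq0.le, Complex.exp_eq_one_iff]
  refine exists_congr fun m => ⟨fun h => ?_, fun h => ?_⟩
  · have : s - 2 = 2 * (Real.pi : ℂ) * Complex.I / (Real.log q : ℂ) * m := by
      field_simp
      linear_combination h
    linear_combination this
  · rw [h]
    field_simp
    ring

lemma isOpen_qDomain {q : ℝ} (hq0 : 0 < q) : IsOpen (qDomain q) :=
  (isOpen_lt continuous_const Complex.continuous_re).inter
    (isOpen_ne_fun (differentiable_qx hq0).continuous continuous_const)

/-- A half-plane in `ℂ` with countably many points removed is connected. -/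
lemma isPreconnected_halfPlane_diff_countable (a : ℝ) {S : Set ℂ} (hS : S.Countable) :
    IsPreconnected ({s : ℂ | a < s.re} \ S) := by
  let f : ℂ → ℂ := fun z => ((a + Real.exp z.re : ℝ) : ℂ) + z.im * Complex.I
  have hre : ∀ z, (f z).re = a + Real.exp z.re := fun z => by
    simp only [f, Complex.add_re, Complex.re_ofReal_mul, Complex.ofReal_re, Complex.I_re,
      mul_zero, add_zero]
  have him : ∀ z, (f z).im = z.im := fun z => by
    simp only [f, Complex.add_im, Complex.im_ofReal_mul, Complex.ofReal_im, Complex.I_im,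
      mul_one, zero_add]
  have hinj : Function.Injective f := fun z w h => by
    have h1 := congrArg Complex.re h
    have h2 := congrArg Complex.im h
    rw [hre, hre] at h1
    rw [him, him] at h2
    exact Complex.ext (Real.exp_injective (add_left_cancel h1)) h2
  have hcont : Continuous f := by fun_prop
  have himg : {s : ℂ | a < s.re} \ S = f '' (f ⁻¹' S)ᶜ := by
    ext s
    constructor
    · rintro ⟨h1, h2⟩
      have h1 : a < s.re := h1
      have hs : f ⟨Real.log (s.re - a), s.im⟩ = s := by
        apply Complex.ext
        · rw [hre, Real.exp_log (sub_pos.2 h1)]; ring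
        · rw [him]
      exact ⟨_, by rwa [Set.mem_compl_iff, Set.mem_preimage, hs], hs⟩
    · rintro ⟨z, hz, rfl⟩
      refine ⟨?_, hz⟩
      have := Real.exp_pos z.re
      simp only [Set.mem_ofPred_eq, hre]
      linarith
  rw [himg]
  have hrank : 1 < Module.rank ℝ ℂ := by rw [Complex.rank_real_complex]; norm_num
  exact ((hS.preimage hinj).isConnected_compl_of_one_lt_rank hrank).isPreconnected.image f
    hcont.continuousOn

lemma isPreconnected_qDomain {q : ℝ} (hq0 : 0 < q) (hq1 : q < 1) :
    IsPreconnected (qDomain q) := by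
  have hS : {s : ℂ | qx q s = 1}.Countable := by
    refine (Set.countable_range fun m : ℤ =>
      (2 : ℂ) + 2 * (Real.pi : ℂ) * Complex.I / (Real.log q : ℂ) * m).mono fun s hs => ?_
    obtain ⟨m, hm⟩ := (qx_eq_one_iff hq0 hq1 s).1 hs
    exact ⟨m, hm.symm⟩
  exact isPreconnected_halfPlane_diff_countable 1 hS

/-- Holomorphic functions on `qDomain q` agreeing for `Re s > 2` are equal. -/
lemma eqOn_qDomain {q : ℝ} (hq0 : 0 < q) (hq1 : q < 1) {f g : ℂ → ℂ}
    (hf : DifferentiableOn ℂ f (qDomain q)) (hg : DifferentiableOn ℂ g (qDomain q))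
    (h : ∀ s : ℂ, 2 < s.re → f s = g s) : Set.EqOn f g (qDomain q) := by
  have hU := isOpen_qDomain hq0
  have h3 : (3 : ℂ) ∈ {s : ℂ | 2 < s.re} := by norm_num
  have h3' : (3 : ℂ) ∈ qDomain q := by
    refine ⟨by norm_num, fun h1 => ?_⟩
    have := norm_qx_lt_one hq0 hq1 h3
    rw [h1, norm_one] at this
    exact lt_irrefl _ this
  refine (hf.analyticOnNhd hU).eqOn_of_preconnected_of_eventuallyEq (hg.analyticOnNhd hU)
    (isPreconnected_qDomain hq0 hq1) h3' ?_
  filter_upwards [(isOpen_lt continuous_const Complex.continuous_re).mem_nhds h3] with s hs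
  exact h s hs

lemma differentiableOn_qx_div {q : ℝ} (hq0 : 0 < q) :
    DifferentiableOn ℂ (fun s => qx q s / (1 - qx q s)) (qDomain q) :=
  (differentiable_qx hq0).differentiableOn.div
    ((differentiable_qx hq0).differentiableOn.const_sub 1)
    fun _ hs => sub_ne_zero.2 (Ne.symm hs.2)

lemma qDomain_subset (q : ℝ) : qDomain q ⊆ {s | 1 < s.re} := fun _ hs => hs.1

lemma differentiableOn_contDiffTerm {q : ℝ} (hq0 : 0 < q) (hq1 : q < 1) (n : ℕ) :
    DifferentiableOn ℂ (contDiffTerm q n) (qDomain q) := by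
  have h1 := (((locallyDominated_regL hq0 hq1).sub (locallyDominated_regR hq0 hq1)).fiber
    n).differentiableOn_tsum hq0 hq1 fun p =>
      (differentiable_regL hq0 hq1 (n, p)).sub (differentiable_regR hq0 hq1 (n, p))
  have h2 := (((locallyDominated_geoL hq0 hq1).sub (locallyDominated_geoR hq0 hq1)).fiber
    n).differentiableOn_tsum hq0 hq1 fun j =>
      (differentiable_const _).sub (differentiable_geoR hq0 (n, j))
  exact (h1.mono (qDomain_subset q)).add
    ((differentiableOn_qx_div hq0).mul (h2.mono (qDomain_subset q)))

/-- The sum formula on the whole domain, in terms of the regularised series. -/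
lemma hasSum_contDiffTerm {q : ℝ} (hq0 : 0 < q) (hq1 : q < 1) {s : ℂ} (hs : s ∈ qDomain q) :
    HasSum (fun n => contDiffTerm q n s) (∑' N, zetaFam q N s) := by
  have hr := (locallyDominated_regL hq0 hq1).sub (locallyDominated_regR hq0 hq1)
  have hg := (locallyDominated_geoL hq0 hq1).sub (locallyDominated_geoR hq0 hq1)
  have hreg := hr.differentiableOn_tsum hq0 hq1 fun p =>
    (differentiable_regL hq0 hq1 p).sub (differentiable_regR hq0 hq1 p)
  have hgeo := hg.differentiableOn_tsum hq0 hq1 fun p =>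
    (differentiable_const _).sub (differentiable_geoR hq0 p)
  have hzeta := (locallyDominated_zetaFam hq0 hq1).differentiableOn_tsum hq0 hq1
    (differentiable_zetaFam hq0 hq1)
  have key := eqOn_qDomain hq0 hq1
    ((hreg.mono (qDomain_subset q)).add
      ((differentiableOn_qx_div hq0).mul (hgeo.mono (qDomain_subset q))))
    (hzeta.mono (qDomain_subset q)) (fun s hs => regularised_sum_formula hq0 hq1 hs) hs
  simp only [Pi.add_apply, Pi.mul_apply] at key
  rw [← key]
  have h1 := hr.summable hq0 hq1 hs.1
  have h2 := hg.summable hq0 hq1 hs.1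
  exact (h1.hasSum.prod_fiberwise fun n => (h1.prod_factor n).hasSum).add
    ((h2.hasSum.prod_fiberwise fun n => (h2.prod_factor n).hasSum).mul_left _)

lemma re_add_two_pi_mul (q a : ℝ) (m : ℤ) :
    ((a : ℂ) + 2 * (Real.pi : ℂ) * Complex.I / (Real.log q : ℂ) * m).re = a := by
  have : 2 * (Real.pi : ℂ) * Complex.I / (Real.log q : ℂ) * m =
      ((2 * Real.pi / Real.log q * m : ℝ) : ℂ) * Complex.I := by push_cast; ring
  rw [this, Complex.add_re, Complex.re_ofReal_mul, Complex.I_re, mul_zero, add_zero,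
    Complex.ofReal_re]

/-- Points with `Re s₂ > 1` and `s₁ + s₂` in `qDomain q` are not singular. -/
lemma mem_compl_badSet {q : ℝ} (hq0 : 0 < q) (hq1 : q < 1) {s₁ s₂ : ℂ} (h2 : 1 < s₂.re)
    (h : s₁ + s₂ ∈ qDomain q) : (s₁, s₂) ∈ (badSet q)ᶜ := by
  rintro (⟨m, hm⟩ | ⟨k, hk, m, -, hm⟩ | ⟨k, hk, m, hm⟩)
  · have := re_add_two_pi_mul q 1 m
    simp only at hm
    rw [Complex.ofReal_one, ← hm] at this
    linarith
  · have := re_add_two_pi_mul q k m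
    simp only at hm
    rw [Complex.ofReal_intCast, ← hm] at this
    have hk' : (k : ℝ) ≤ 0 := by exact_mod_cast hk
    linarith
  · have := re_add_two_pi_mul q k m
    simp only at hm
    rw [Complex.ofReal_intCast, ← hm] at this
    have h1 := h.1
    rw [this] at h1
    have hk1 : 1 < k := by exact_mod_cast h1
    obtain rfl : k = 2 := by omega
    exact h.2 ((qx_eq_one_iff hq0 hq1 _).2 ⟨m, by rw [hm]; norm_num⟩)

/-- If `Z` is holomorphic on `ℂ² ∖ 𝔖` and agrees with the depth-2 `q`-multiple zeta series
on its domain of absolute convergence, then for every `s` with `Re(s) > 1` and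
`s ∉ 2 + (2πi/log q)ℤ`, the series `Σ_{n=0}^∞ (Z(s−n−2, n+2) − Z(−n, s+n))` converges and
equals `ζ_q(s)`. -/
theorem qzeta_sum_formula_interpolated (q : ℝ) (hq0 : 0 < q) (hq1 : q < 1)
    (Z : ℂ × ℂ → ℂ) (hZhol : DifferentiableOn ℂ Z (badSet q)ᶜ)
    (hZval : ∀ s₁ s₂ : ℂ, 1 < s₂.re → 2 < (s₁ + s₂).re →
      Z (s₁, s₂) = ∑' p : I2, zterm2 q s₁ s₂ p.1)
    (s : ℂ) (hs : 1 < s.re)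
    (hs2 : ¬∃ m : ℤ, s = 2 + 2 * (Real.pi : ℂ) * Complex.I / (Real.log q : ℂ) * m) :
    HasSum (fun n : ℕ => Z (s - n - 2, (n : ℂ) + 2) - Z (-(n : ℂ), s + n))
      (∑' n : {n : ℕ // 0 < n}, zterm1 q s n.1) := by
  have hmem : s ∈ qDomain q := ⟨hs, fun h => hs2 ((qx_eq_one_iff hq0 hq1 s).1 h)⟩
  have h1q : ((1 - q : ℝ) : ℂ) ≠ 0 := by exact_mod_cast (sub_pos.2 hq1).ne'
  rw [tsum_zterm1 hq0 hq1]
  refine ((hasSum_contDiffTerm hq0 hq1 hmem).mul_left (((1 - q : ℝ) : ℂ) ^ s)).of_eq_of_eq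
    (fun n => ?_) rfl
  have hpow : DifferentiableOn ℂ (fun s : ℂ => ((1 - q : ℝ) : ℂ) ^ s) (qDomain q) :=
    (differentiable_id.const_cpow (Or.inl h1q)).differentiableOn
  have hreL : 1 < ((n : ℂ) + 2).re := by
    simp only [Complex.add_re, Complex.natCast_re, Complex.re_ofNat]
    linarith [(Nat.cast_nonneg n : (0 : ℝ) ≤ n)]
  have hreR : ∀ z : ℂ, 1 < z.re → 1 < (z + n).re := fun z hz => by
    simp only [Complex.add_re, Complex.natCast_re]
    linarith [(Nat.cast_nonneg n : (0 : ℝ) ≤ n)]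
  have hsumL : ∀ z : ℂ, z - n - 2 + ((n : ℂ) + 2) = z := fun z => by ring
  have hsumR : ∀ z : ℂ, -(n : ℂ) + (z + n) = z := fun z => by ring
  have hL : DifferentiableOn ℂ (fun z : ℂ => Z (z - n - 2, (n : ℂ) + 2)) (qDomain q) :=
    hZhol.comp (f := fun z : ℂ => (z - n - 2, (n : ℂ) + 2)) (by fun_prop) fun z hz =>
      mem_compl_badSet hq0 hq1 hreL (by rwa [hsumL])
  have hR : DifferentiableOn ℂ (fun z : ℂ => Z (-(n : ℂ), z + n)) (qDomain q) :=
    hZhol.comp (f := fun z : ℂ => (-(n : ℂ), z + n)) (by fun_prop) fun z hz =>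
      mem_compl_badSet hq0 hq1 (hreR z hz.1) (by rwa [hsumR])
  refine eqOn_qDomain hq0 hq1 (hL.sub hR) (hpow.mul (differentiableOn_contDiffTerm hq0 hq1 n))
    (fun z hz => ?_) hmem
  simp only [Pi.sub_apply, Pi.mul_apply]
  rw [hZval _ _ hreL (by rwa [hsumL]), hZval _ _ (hreR z (by linarith)) (by rwa [hsumR]),
    tsum_zterm2_left hq0 hq1, tsum_zterm2_right hq0 hq1, ← mul_sub,
    sub_tsum_eq_contDiffTerm hq0 hq1 hz]
end
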